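/- For each v ∈ X with v ≥ 0, there exists a unique viscosity solution u ∈ X of the equation F(D²u) − (1/2) y·Du = v in ℝⁿ. Moreover, this solution u belongs to D, i.e., 0 ≤ u(y) ≤ C e^{−b|y|²} for all y ∈ ℝⁿ and some constant C > 0. -/

import Mathlib

noncomputable section

open Filter Matrix Real Set
open scoped Topology

/-- Euclidean `n`-space `ℝⁿ`. -/
abbrev En (n : ℕ) := EuclideanSpace ℝ (Fin n)

/-- `n × n` real matrices. -/
abbrev Mat (n : ℕ) := Matrix (Fin n) (Fin n) ℝ

/-- The set of symmetric positive definite matrices whose eigenvalues all lie in `[lam, Lam]`. -/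
def PucciMatrices (n : ℕ) (lam Lam : ℝ) : Set (Mat n) :=
  { A | ∃ hA : A.IsHermitian, ∀ i, hA.eigenvalues i ∈ Set.Icc lam Lam }

/-- The Pucci maximal operator `P⁺(M) = sup {-tr(AM) : A ∈ PucciMatrices}`. -/
def PucciPlus (n : ℕ) (lam Lam : ℝ) (M : Mat n) : ℝ :=
  sSup ((fun A => -(A * M).trace) '' PucciMatrices n lam Lam)

/-- The Pucci minimal operator `P⁻(M) = inf {-tr(AM) : A ∈ PucciMatrices}`. -/
def PucciMinus (n : ℕ) (lam Lam : ℝ) (M : Mat n) : ℝ :=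
  sInf ((fun A => -(A * M).trace) '' PucciMatrices n lam Lam)

/-- `F` is uniformly elliptic with ellipticity constants `lam ≤ Lam`. -/
def UniformlyElliptic (n : ℕ) (lam Lam : ℝ) (F : Mat n → ℝ) : Prop :=
  ∀ M N : Mat n, M.IsSymm → N.IsSymm →
    PucciMinus n lam Lam (M - N) ≤ F M - F N ∧ F M - F N ≤ PucciPlus n lam Lam (M - N)

/-- `F` is positively homogeneous of order one. -/
def PositivelyHomogeneous (n : ℕ) (F : Mat n → ℝ) : Prop :=
  ∀ (M : Mat n), ∀ η : ℝ, 0 ≤ η → F (η • M) = η * F M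

/-- The Hessian matrix of `φ : ℝⁿ → ℝ` at a point `y`. -/
def hess (n : ℕ) (φ : En n → ℝ) (y : En n) : Mat n :=
  Matrix.of fun i j =>
    fderiv ℝ (fun z => fderiv ℝ φ z (EuclideanSpace.single j 1)) y (EuclideanSpace.single i 1)

/-- Viscosity subsolution of the elliptic equation `G(D²u, Du, u, y) = 0` on `Ω`,
i.e. `G[u] ≤ 0` in the viscosity sense. -/
def ViscSubE (n : ℕ) (Ω : Set (En n))
    (G : Mat n → (En n →L[ℝ] ℝ) → ℝ → En n → ℝ) (u : En n → ℝ) : Prop :=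
  ∀ y ∈ Ω, ∀ φ : En n → ℝ, ContDiff ℝ 2 φ →
    IsLocalMaxOn (fun z => u z - φ z) Ω y →
    G (hess n φ y) (fderiv ℝ φ y) (u y) y ≤ 0

/-- Viscosity supersolution of the elliptic equation `G(D²u, Du, u, y) = 0` on `Ω`,
i.e. `G[u] ≥ 0` in the viscosity sense. -/
def ViscSupE (n : ℕ) (Ω : Set (En n))
    (G : Mat n → (En n →L[ℝ] ℝ) → ℝ → En n → ℝ) (u : En n → ℝ) : Prop :=
  ∀ y ∈ Ω, ∀ φ : En n → ℝ, ContDiff ℝ 2 φ →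
    IsLocalMinOn (fun z => u z - φ z) Ω y →
    0 ≤ G (hess n φ y) (fderiv ℝ φ y) (u y) y

/-- Viscosity solution of the elliptic equation `G(D²u, Du, u, y) = 0` on `Ω`. -/
def ViscSolE (n : ℕ) (Ω : Set (En n))
    (G : Mat n → (En n →L[ℝ] ℝ) → ℝ → En n → ℝ) (u : En n → ℝ) : Prop :=
  ViscSubE n Ω G u ∧ ViscSupE n Ω G u

/-- Time derivative of `φ : ℝⁿ × ℝ → ℝ` at `p = (x, t)`. -/
def tderiv (n : ℕ) (φ : En n × ℝ → ℝ) (p : En n × ℝ) : ℝ :=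
  deriv (fun s => φ (p.1, s)) p.2

/-- Spatial Hessian of `φ : ℝⁿ × ℝ → ℝ` at `p = (x, t)`. -/
def shess (n : ℕ) (φ : En n × ℝ → ℝ) (p : En n × ℝ) : Mat n :=
  hess n (fun z => φ (z, p.2)) p.1

/-- Spatial differential of `φ : ℝⁿ × ℝ → ℝ` at `p = (x, t)`. -/
def sgrad (n : ℕ) (φ : En n × ℝ → ℝ) (p : En n × ℝ) : En n →L[ℝ] ℝ :=
  fderiv ℝ (fun z => φ (z, p.2)) p.1

/-- Viscosity subsolution of the parabolic equation `u_t + G(D²u, Du, u, (x,t)) = 0` on `Ω`. -/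
def ViscSubP (n : ℕ) (Ω : Set (En n × ℝ))
    (G : Mat n → (En n →L[ℝ] ℝ) → ℝ → En n × ℝ → ℝ) (u : En n × ℝ → ℝ) : Prop :=
  ∀ p ∈ Ω, ∀ φ : En n × ℝ → ℝ, ContDiff ℝ 2 φ →
    IsLocalMaxOn (fun q => u q - φ q) Ω p →
    tderiv n φ p + G (shess n φ p) (sgrad n φ p) (u p) p ≤ 0

/-- Viscosity supersolution of the parabolic equation `u_t + G(D²u, Du, u, (x,t)) = 0` on `Ω`. -/
def ViscSupP (n : ℕ) (Ω : Set (En n × ℝ))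
    (G : Mat n → (En n →L[ℝ] ℝ) → ℝ → En n × ℝ → ℝ) (u : En n × ℝ → ℝ) : Prop :=
  ∀ p ∈ Ω, ∀ φ : En n × ℝ → ℝ, ContDiff ℝ 2 φ →
    IsLocalMinOn (fun q => u q - φ q) Ω p →
    0 ≤ tderiv n φ p + G (shess n φ p) (sgrad n φ p) (u p) p

/-- Viscosity solution of the parabolic equation `u_t + G(D²u, Du, u, (x,t)) = 0` on `Ω`. -/
def ViscSolP (n : ℕ) (Ω : Set (En n × ℝ))
    (G : Mat n → (En n →L[ℝ] ℝ) → ℝ → En n × ℝ → ℝ) (u : En n × ℝ → ℝ) : Prop :=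
  ViscSubP n Ω G u ∧ ViscSupP n Ω G u

/-- The parabolic domain `ℝⁿ × ℝ₊`. -/
def Qset (n : ℕ) : Set (En n × ℝ) := {p | 0 < p.2}

/-- The elliptic operator `F(D²u) - (1/2) y·Du - α u - f(y)`. -/
def Fop (n : ℕ) (F : Mat n → ℝ) (α : ℝ) (f : En n → ℝ) :
    Mat n → (En n →L[ℝ] ℝ) → ℝ → En n → ℝ :=
  fun M p v y => F M - (1/2) * p y - α * v - f y

/-- Membership in the space `X` with weight `b`: continuity and finiteness of the norm. -/
def memX (n : ℕ) (b : ℝ) (u : En n → ℝ) : Prop :=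
  Continuous u ∧ BddAbove (Set.range fun y : En n => |u y| * Real.exp (b * ‖y‖ ^ 2) / (1 + ‖y‖ ^ 2))

/-- The norm `‖u‖_X = sup_y |u(y)| e^{b|y|²} / (1 + |y|²)`. -/
def normX (n : ℕ) (b : ℝ) (u : En n → ℝ) : ℝ :=
  sSup (Set.range fun y : En n => |u y| * Real.exp (b * ‖y‖ ^ 2) / (1 + ‖y‖ ^ 2))

/-- The positive anomalous exponent `α⁺(F)`. -/
def alphaPlus (n : ℕ) (lam Lam : ℝ) (F : Mat n → ℝ) : ℝ :=
  sSup { α : ℝ | ∃ φ : En n → ℝ, memX n (1/(8*Lam)) φ ∧ (∀ y, 0 ≤ φ y) ∧ φ ≠ 0 ∧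
    ViscSupE n Set.univ (Fop n F α (fun _ => 0)) φ }

/-- `Φ` is a positive self-similar solution of `u_t + F(D²u) = 0` with exponent `α`,
with a Gaussian upper bound at time one. -/
def IsSelfSimilarPlus (n : ℕ) (F : Mat n → ℝ) (α : ℝ) (Φ : En n × ℝ → ℝ) : Prop :=
  ContinuousOn Φ (Qset n) ∧
  (∀ p ∈ Qset n, 0 < Φ p) ∧
  ViscSolP n (Qset n) (fun M _ _ _ => F M) Φ ∧
  (∀ σ : ℝ, 0 < σ → ∀ x : En n, ∀ t : ℝ, 0 < t →
    Φ (x, t) = σ ^ α * Φ (Real.sqrt σ • x, σ * t)) ∧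
  (∃ C : ℝ, 0 < C ∧ ∃ a : ℝ, 0 < a ∧ ∀ x : En n, Φ (x, 1) ≤ C * Real.exp (-a * ‖x‖ ^ 2))

/-- `Φ` is a negative self-similar solution of `u_t + F(D²u) = 0` with exponent `α`,
with a Gaussian lower bound at time one. -/
def IsSelfSimilarMinus (n : ℕ) (F : Mat n → ℝ) (α : ℝ) (Φ : En n × ℝ → ℝ) : Prop :=
  ContinuousOn Φ (Qset n) ∧
  (∀ p ∈ Qset n, Φ p < 0) ∧
  ViscSolP n (Qset n) (fun M _ _ _ => F M) Φ ∧
  (∀ σ : ℝ, 0 < σ → ∀ x : En n, ∀ t : ℝ, 0 < t →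
    Φ (x, t) = σ ^ α * Φ (Real.sqrt σ • x, σ * t)) ∧
  (∃ C : ℝ, 0 < C ∧ ∃ a : ℝ, 0 < a ∧ ∀ x : En n, -Φ (x, 1) ≤ C * Real.exp (-a * ‖x‖ ^ 2))

/-- The set `S` of locally uniform sequential limits of the rescalings
`u^σ(x,t) = σ^α u(σ^{1/2} x, σ t)` as `σ → ∞`. -/
def limitSet (n : ℕ) (α : ℝ) (u : En n × ℝ → ℝ) : Set (En n × ℝ → ℝ) :=
  { U | ContinuousOn U (Qset n) ∧ ∃ σ : ℕ → ℝ,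
      Tendsto σ atTop atTop ∧
      TendstoLocallyUniformlyOn
        (fun k (p : En n × ℝ) => (σ k) ^ α * u (Real.sqrt (σ k) • p.1, σ k * p.2))
        U atTop (Qset n) }

section Calculus

variable {E : Type*} [NormedAddCommGroup E] [NormedSpace ℝ E]

/-- Second-order Taylor expansion when the gradient is differentiable at one point. -/
theorem taylor_second_order {f : E → ℝ} {P : E → E →L[ℝ] ℝ} {B : E →L[ℝ] E →L[ℝ] ℝ} {x : E}
    (hf : ∀ y, HasFDerivAt f (P y) y) (hP : HasFDerivAt P B x)
    (hB : ∀ k l, B k l = B l k) {η : ℝ} (hη : 0 < η) :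
    ∀ᶠ k in 𝓝 (0 : E), |f (x + k) - f x - P x k - 1 / 2 * B k k| ≤ η * ‖k‖ ^ 2 := by
  have h1 : ∀ᶠ k in 𝓝 (0 : E), ‖P (x + k) - P x - B k‖ ≤ η * ‖k‖ := by
    have := hasFDerivAt_iff_isLittleO_nhds_zero.1 hP
    exact this.def hη
  obtain ⟨r, hr, hball⟩ := Metric.eventually_nhds_iff_ball.1 h1
  filter_upwards [Metric.ball_mem_nhds (0 : E) hr] with k hk
  have hk' : ‖k‖ < r := by simpa using hk
  set g : E → ℝ := fun l => f (x + l) - f x - P x l - 1 / 2 * B l l with hg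
  have hder : ∀ l, HasFDerivAt g (P (x + l) - P x - B l) l := by
    intro l
    have e1 : HasFDerivAt (fun l => f (x + l)) (P (x + l)) l := by
      have := (hf (x + l)).comp l ((hasFDerivAt_id l).const_add x)
      exact this.congr_fderiv (ContinuousLinearMap.comp_id _)
    have e2 : HasFDerivAt (fun l => B l l) (B l + B.flip l) l := by
      have := (B.hasFDerivAt (x := l)).clm_apply (hasFDerivAt_id l)
      refine this.congr_fderiv ?_
      ext m; simp
    refine (((e1.sub_const (f x)).sub (P x).hasFDerivAt).sub (e2.const_mul (1 / 2))).congr_fderiv ?_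
    ext m
    simp [hB m l]
    ring
  have := (convex_closedBall (0 : E) ‖k‖).norm_image_sub_le_of_norm_hasFDerivWithin_le
    (f := g) (f' := fun l => P (x + l) - P x - B l) (C := η * ‖k‖) (x := 0) (y := k)
    (fun l _ => (hder l).hasFDerivWithinAt)
    (fun l hl => by
      have hl' : ‖l‖ ≤ ‖k‖ := by simpa using hl
      refine (hball l (by simpa using hl'.trans_lt hk')).trans ?_
      gcongr) (by simp) (by simp)
  have h0 : g 0 = 0 := by simp [hg]
  rw [h0] at this
  simpa [hg, pow_two, mul_assoc] using this

theorem bilin_le_of_eventually {B : E →L[ℝ] E →L[ℝ] ℝ} {c : ℝ}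
    (h : ∀ η > 0, ∀ᶠ k in 𝓝 (0 : E), B k k ≤ c * ‖k‖ ^ 2 + η * ‖k‖ ^ 2) (k : E) :
    B k k ≤ c * ‖k‖ ^ 2 := by
  refine le_of_forall_pos_le_add fun η hη => ?_
  have hpos : 0 < η / (‖k‖ ^ 2 + 1) := by positivity
  have h1 := h _ hpos
  have ht : Tendsto (fun t : ℝ => t • k) (𝓝[>] 0) (𝓝 (0 : E)) := by
    have : Tendsto (fun t : ℝ => t • k) (𝓝 0) (𝓝 ((0 : ℝ) • k)) :=
      (continuous_id.smul continuous_const).tendsto 0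
    rw [zero_smul] at this
    exact this.mono_left nhdsWithin_le_nhds
  obtain ⟨t, ht1, ht0⟩ := ((ht.eventually h1).and self_mem_nhdsWithin).exists
  have ht0' : (0 : ℝ) < t := ht0
  simp only [map_smul, _root_.smul_apply, smul_eq_mul, norm_smul, mul_pow,
    Real.norm_eq_abs, sq_abs] at ht1
  have h2 : t ^ 2 * B k k ≤ t ^ 2 * (c * ‖k‖ ^ 2 + η / (‖k‖ ^ 2 + 1) * ‖k‖ ^ 2) := by linarith
  have h3 := le_of_mul_le_mul_left h2 (by positivity)
  have h4 : η / (‖k‖ ^ 2 + 1) * ‖k‖ ^ 2 ≤ η := by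
    rw [div_mul_eq_mul_div, div_le_iff₀ (by positivity)]
    nlinarith [sq_nonneg ‖k‖]
  linarith

theorem clm_eq_zero_of_le_sq {ℓ : E →L[ℝ] ℝ} {C : ℝ} (h : ∀ᶠ k in 𝓝 0, ℓ k ≤ C * ‖k‖ ^ 2) :
    ℓ = 0 := by
  have hle : ∀ k, ℓ k ≤ 0 := by
    intro k
    by_contra! hk
    have hlim : Tendsto (fun t : ℝ => C * (t * ‖k‖ ^ 2)) (𝓝[>] 0) (𝓝 (C * (0 * ‖k‖ ^ 2))) :=
      Tendsto.mono_left ((by fun_prop : Continuous fun t : ℝ => C * (t * ‖k‖ ^ 2)).tendsto 0)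
        nhdsWithin_le_nhds
    rw [zero_mul, mul_zero] at hlim
    have ht : Tendsto (fun t : ℝ => t • k) (𝓝[>] 0) (𝓝 (0 : E)) := by
      have : Tendsto (fun t : ℝ => t • k) (𝓝 0) (𝓝 ((0 : ℝ) • k)) :=
        (continuous_id.smul continuous_const).tendsto 0
      rw [zero_smul] at this
      exact this.mono_left nhdsWithin_le_nhds
    obtain ⟨t, ⟨ht1, ht2⟩, ht0⟩ := (((hlim.eventually_lt_const hk).and (ht.eventually h)).and
      self_mem_nhdsWithin).exists
    have ht0' : (0 : ℝ) < t := ht0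
    simp only [map_smul, smul_eq_mul, norm_smul, mul_pow, Real.norm_eq_abs, sq_abs] at ht2
    nlinarith
  ext k
  have := hle (-k)
  rw [map_neg] at this
  exact le_antisymm (hle k) (by simpa using this)

/-- A function trapped between paraboloids at every point is `C^{1,1}`. -/
theorem hasFDerivAt_and_lipschitz_of_pinned {f : E → ℝ} {P : E → E →L[ℝ] ℝ} {K : ℝ}
    (hK : 0 ≤ K) (h : ∀ x k, |f (x + k) - f x - P x k| ≤ K * ‖k‖ ^ 2) :
    (∀ x, HasFDerivAt f (P x) x) ∧ LipschitzWith (6 * K).toNNReal P := by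
  constructor
  · intro x
    rw [hasFDerivAt_iff_isLittleO_nhds_zero]
    have h1 : (fun k : E => f (x + k) - f x - P x k) =O[𝓝 0] fun k => ‖k‖ ^ 2 :=
      Asymptotics.IsBigO.of_bound K (Eventually.of_forall fun k => by
        simpa using h x k)
    refine h1.trans_isLittleO ?_
    have := Asymptotics.isLittleO_norm_pow_id (E' := E) (n := 2) (by norm_num)
    exact this
  · refine LipschitzWith.of_dist_le_mul fun y x => ?_
    rw [dist_eq_norm, dist_eq_norm, Real.coe_toNNReal _ (by positivity)]
    obtain ⟨d, rfl⟩ : ∃ d, y = x + d := ⟨y - x, by simp⟩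
    simp only [add_sub_cancel_left]
    by_cases hd : d = 0
    · simp [hd]
    have hd' : 0 < ‖d‖ := norm_pos_iff.2 hd
    refine ContinuousLinearMap.opNorm_le_of_unit_norm (by positivity) fun e he => ?_
    set k : E := ‖d‖ • e with hk
    have hkn : ‖k‖ = ‖d‖ := by simp [hk, norm_smul, he]
    have a1 := h x (d + k)
    have a2 := h x d
    have a3 := h (x + d) k
    have hn : ‖d + k‖ ^ 2 ≤ 4 * ‖d‖ ^ 2 := by
      have := norm_add_le d k
      rw [hkn] at this
      nlinarith [norm_nonneg (d + k)]
    rw [hkn] at a3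
    rw [← add_assoc, map_add] at a1
    have key : |(P (x + d) - P x) k| ≤ 6 * K * ‖d‖ ^ 2 := by
      have : K * ‖d + k‖ ^ 2 ≤ K * (4 * ‖d‖ ^ 2) := by gcongr
      rw [_root_.sub_apply]
      rw [abs_le] at *
      constructor <;> linarith [a1.1, a1.2, a2.1, a2.2, a3.1, a3.2]
    rw [hk, map_smul, smul_eq_mul, abs_mul, abs_of_pos hd'] at key
    rw [Real.norm_eq_abs]
    nlinarith

end Calculus

theorem UpperSemicontinuous.exists_forall_le_of_cocompact {X : Type*} [TopologicalSpace X]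
    {g : X → ℝ} (hg : UpperSemicontinuous g) (x₀ : X)
    (h : ∀ᶠ x in cocompact X, g x ≤ g x₀) : ∃ x, ∀ y, g y ≤ g x := by
  obtain ⟨t, ht, hsub⟩ := mem_cocompact.1 h
  obtain ⟨x, -, hx⟩ := UpperSemicontinuousOn.exists_isMaxOn (s := insert x₀ t) ⟨x₀, mem_insert _ _⟩
    (ht.insert x₀) (hg.upperSemicontinuousOn _)
  refine ⟨x, fun y => ?_⟩
  by_cases hy : y ∈ t
  · exact hx (mem_insert_of_mem _ hy)
  · exact (hsub hy : g y ≤ g x₀).trans (hx (mem_insert _ _))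

section Regularization

variable {E : Type*} [NormedAddCommGroup E] [InnerProductSpace ℝ E]

theorem add_sq_div_add_le {a b ε δ : ℝ} (hε : 0 < ε) (hδ : 0 < δ) :
    (a + b) ^ 2 / (2 * (ε + δ)) ≤ a ^ 2 / (2 * ε) + b ^ 2 / (2 * δ) := by
  rw [div_add_div _ _ (by positivity) (by positivity), div_le_div_iff₀ (by positivity) (by positivity)]
  nlinarith [mul_nonneg (add_pos hε hδ).le (sq_nonneg (a * δ - b * ε))]

theorem exists_supConv [FiniteDimensional ℝ E] {u : E → ℝ} (hu : UpperSemicontinuous u) {M : ℝ}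
    (hM : ∀ x, u x ≤ M) {s : ℝ} (hs : 0 < s) :
    ∃ U : E → ℝ, ∃ z : E → E, (∀ x, U x = u (z x) - ‖x - z x‖ ^ 2 / (2 * s)) ∧
      ∀ x y, u y - ‖x - y‖ ^ 2 / (2 * s) ≤ U x := by
  have key : ∀ x, ∃ z, ∀ y, u y - ‖x - y‖ ^ 2 / (2 * s) ≤ u z - ‖x - z‖ ^ 2 / (2 * s) := by
    intro x
    have hcont : Continuous fun y : E => -(‖x - y‖ ^ 2 / (2 * s)) := by fun_prop
    have husc : UpperSemicontinuous fun y => u y - ‖x - y‖ ^ 2 / (2 * s) := by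
      simpa only [sub_eq_add_neg] using hu.add hcont.upperSemicontinuous
    refine husc.exists_forall_le_of_cocompact x ?_
    have ht : Tendsto (fun y : E => ‖x - y‖) (cocompact E) atTop := by
      simpa [dist_eq_norm, norm_sub_rev] using tendsto_dist_right_cocompact_atTop x
    have ht2 : Tendsto (fun y : E => ‖x - y‖ ^ 2) (cocompact E) atTop :=
      (tendsto_pow_atTop two_ne_zero).comp ht
    filter_upwards [ht2.eventually_ge_atTop ((M - u x) * (2 * s))] with y hy
    have : M - u x ≤ ‖x - y‖ ^ 2 / (2 * s) := by rwa [le_div_iff₀ (by positivity)]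
    simp
    linarith [hM y]
  choose z hz using key
  exact ⟨fun x => u (z x) - ‖x - z x‖ ^ 2 / (2 * s), z, fun _ => rfl, fun x y => hz x y⟩

/-- Sup-convolution `f` of `u` together with its `C^{1,1}` upper envelope `g`, the infimum of all
paraboloids of opening `1/δ` lying above `f`. -/
theorem exists_regularization [FiniteDimensional ℝ E] {u : E → ℝ} (hu : UpperSemicontinuous u)
    {M : ℝ} (hM : ∀ x, |u x| ≤ M) {ε δ : ℝ} (hε : 0 < ε) (hδ : 0 < δ) :
    ∃ (f : E → ℝ) (z : E → E) (g : E → ℝ) (P : E → E →L[ℝ] ℝ),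
      (∀ x, f x = u (z x) - ‖x - z x‖ ^ 2 / (2 * ε)) ∧
      (∀ x y, u y - ‖x - y‖ ^ 2 / (2 * ε) ≤ f x) ∧
      (∀ x k, g (x + k) ≤ g x + P x k + ‖k‖ ^ 2 / (2 * δ)) ∧
      (∀ x k, g x + P x k - ‖k‖ ^ 2 / (2 * ε) ≤ g (x + k)) ∧
      (∀ x, f x ≤ g x) ∧
      (∀ (c : ℝ) (w : E), (∀ y, f y ≤ c + ‖y - w‖ ^ 2 / (2 * δ)) →
        ∀ y, g y ≤ c + ‖y - w‖ ^ 2 / (2 * δ)) := by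
  have hM' : ∀ x, u x ≤ M := fun x => (abs_le.1 (hM x)).2
  obtain ⟨f, z, hf, hf'⟩ := exists_supConv hu hM' hε
  obtain ⟨U, ζ, hU, hU'⟩ := exists_supConv hu hM' (add_pos hε hδ)
  have hUlsc : LowerSemicontinuous U := by
    intro x c hc
    have hcont : Continuous fun y : E => u (ζ x) - ‖y - ζ x‖ ^ 2 / (2 * (ε + δ)) := by fun_prop
    have : ∀ᶠ y in 𝓝 x, c < u (ζ x) - ‖y - ζ x‖ ^ 2 / (2 * (ε + δ)) :=
      hcont.continuousAt.eventually_const_lt (hc.trans_eq (hU x))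
    filter_upwards [this] with y hy
    exact hy.trans_le (hU' y _)
  have hUb : ∀ x, -U x ≤ M := by
    intro x
    have := hU' x x
    simp at this
    linarith [(abs_le.1 (hM x)).1]
  obtain ⟨V, w, hV, hV'⟩ := exists_supConv (u := fun x => -U x) hUlsc.neg hUb hδ
  refine ⟨f, z, fun x => -V x, fun x => innerSL ℝ ((1 / δ) • (x - w x)), hf, hf', ?_, ?_, ?_, ?_⟩
  · intro x k
    have h1 := hV' (x + k) (w x)
    have h2 := hV x
    have h3 : ‖x + k - w x‖ ^ 2 = ‖x - w x‖ ^ 2 + 2 * inner ℝ (x - w x) k + ‖k‖ ^ 2 := by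
      rw [show x + k - w x = (x - w x) + k by abel, norm_add_sq_real]
    rw [h3] at h1
    simp only [innerSL_apply_apply, real_inner_smul_left]
    rw [h2]
    have : (‖x - w x‖ ^ 2 + 2 * inner ℝ (x - w x) k + ‖k‖ ^ 2) / (2 * δ)
      = ‖x - w x‖ ^ 2 / (2 * δ) + 1 / δ * inner ℝ (x - w x) k + ‖k‖ ^ 2 / (2 * δ) := by
      field_simp
    linarith
  · intro x k
    set a := x - w x with ha
    have star : ∀ h : E, U (w x) + 1 / δ * inner ℝ a h - ‖h‖ ^ 2 / (2 * (ε + δ)) ≤ U (w x + h) := by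
      intro h
      refine le_of_forall_pos_le_add fun η hη => ?_
      obtain ⟨t, ht0, ht1, hts⟩ : ∃ t : ℝ, 0 < t ∧ t ≤ 1 ∧ t * (‖h‖ ^ 2 / (2 * δ)) ≤ η := by
        refine ⟨min 1 (η / (‖h‖ ^ 2 / (2 * δ) + 1)), by positivity, min_le_left _ _, ?_⟩
        have h0 : 0 ≤ ‖h‖ ^ 2 / (2 * δ) := by positivity
        calc _ ≤ (η / (‖h‖ ^ 2 / (2 * δ) + 1)) * (‖h‖ ^ 2 / (2 * δ)) := by
              gcongr; exact min_le_right _ _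
          _ ≤ η := by
            rw [div_mul_eq_mul_div, div_le_iff₀ (by positivity)]
            nlinarith
      have m1 := hV' x (w x + t • h)
      have m2 := hV x
      have e1 : ‖x - (w x + t • h)‖ ^ 2 = ‖a‖ ^ 2 - 2 * t * inner ℝ a h + t ^ 2 * ‖h‖ ^ 2 := by
        rw [show x - (w x + t • h) = a - t • h by rw [ha]; abel, norm_sub_sq_real,
          real_inner_smul_right, norm_smul, mul_pow, Real.norm_eq_abs, sq_abs]
        ring
      rw [e1] at m1
      set ζ' := ζ (w x + t • h) with hζ
      have c0 := hU (w x + t • h)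
      have c1 := hU' (w x) ζ'
      have c2 := hU' (w x + h) ζ'
      set d := w x - ζ' with hd
      have e2 : ‖w x + t • h - ζ'‖ ^ 2 = ‖d‖ ^ 2 + 2 * t * inner ℝ d h + t ^ 2 * ‖h‖ ^ 2 := by
        rw [show w x + t • h - ζ' = d + t • h by rw [hd]; abel, norm_add_sq_real,
          real_inner_smul_right, norm_smul, mul_pow, Real.norm_eq_abs, sq_abs]
        ring
      have e3 : ‖w x + h - ζ'‖ ^ 2 = ‖d‖ ^ 2 + 2 * inner ℝ d h + ‖h‖ ^ 2 := by
        rw [show w x + h - ζ' = d + h by rw [hd]; abel, norm_add_sq_real]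
      rw [← hζ, e2] at c0
      rw [e3] at c2
      have conv : U (w x + t • h) ≤ (1 - t) * U (w x) + t * U (w x + h)
          + t * ((1 - t) * (‖h‖ ^ 2 / (2 * (ε + δ)))) := by
        have k1 := mul_le_mul_of_nonneg_left c1 (sub_nonneg.2 ht1)
        have k2 := mul_le_mul_of_nonneg_left c2 ht0.le
        have e4 : (1 - t) * (u ζ' - ‖d‖ ^ 2 / (2 * (ε + δ)))
            + t * (u ζ' - (‖d‖ ^ 2 + 2 * inner ℝ d h + ‖h‖ ^ 2) / (2 * (ε + δ)))
            + t * ((1 - t) * (‖h‖ ^ 2 / (2 * (ε + δ))))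
            = u ζ' - (‖d‖ ^ 2 + 2 * t * inner ℝ d h + t ^ 2 * ‖h‖ ^ 2) / (2 * (ε + δ)) := by
          ring
        linarith
      have e5 : (‖a‖ ^ 2 - 2 * t * inner ℝ a h + t ^ 2 * ‖h‖ ^ 2) / (2 * δ)
          = ‖a‖ ^ 2 / (2 * δ) - t * (1 / δ * inner ℝ a h) + t * (t * (‖h‖ ^ 2 / (2 * δ))) := by
        field_simp
      rw [e5] at m1
      have hfin : t * (U (w x) + 1 / δ * inner ℝ a h - ‖h‖ ^ 2 / (2 * (ε + δ)))
          ≤ t * (U (w x + h) + η) := by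
        have g1 : t * (t * (‖h‖ ^ 2 / (2 * δ))) ≤ t * η := mul_le_mul_of_nonneg_left hts ht0.le
        have g2 : 0 ≤ t * (t * (‖h‖ ^ 2 / (2 * (ε + δ)))) := by positivity
        linarith
      exact le_of_mul_le_mul_left hfin ht0
    have h1 := hV (x + k)
    have h2 := hV x
    have h3 := star (w (x + k) - w x)
    set h := w (x + k) - w x with hh
    rw [show w x + h = w (x + k) by rw [hh]; abel] at h3
    have e1 : ‖x + k - w (x + k)‖ ^ 2
        = ‖a‖ ^ 2 + 2 * inner ℝ a k - 2 * inner ℝ a h + ‖k - h‖ ^ 2 := by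
      rw [show x + k - w (x + k) = a + (k - h) by rw [ha, hh]; abel, norm_add_sq_real,
        inner_sub_right]
      ring
    rw [e1] at h1
    have e2 : (‖a‖ ^ 2 + 2 * inner ℝ a k - 2 * inner ℝ a h + ‖k - h‖ ^ 2) / (2 * δ)
        = ‖a‖ ^ 2 / (2 * δ) + 1 / δ * inner ℝ a k - 1 / δ * inner ℝ a h
          + ‖k - h‖ ^ 2 / (2 * δ) := by
      field_simp
    have e3 : ‖h‖ ^ 2 / (2 * (ε + δ)) ≤ ‖k‖ ^ 2 / (2 * ε) + ‖k - h‖ ^ 2 / (2 * δ) := by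
      refine le_trans ?_ (add_sq_div_add_le hε hδ)
      have : ‖h‖ ≤ ‖k‖ + ‖k - h‖ := by
        simpa using norm_sub_le k (k - h)
      gcongr
    simp only [innerSL_apply_apply, real_inner_smul_left]
    linarith
  · intro x
    have h1 := hV x
    have h2 := hf x
    have h3 := hU' (w x) (z x)
    have e3 : ‖w x - z x‖ ^ 2 / (2 * (ε + δ))
        ≤ ‖x - z x‖ ^ 2 / (2 * ε) + ‖x - w x‖ ^ 2 / (2 * δ) := by
      refine le_trans ?_ (add_sq_div_add_le hε hδ)
      have : ‖w x - z x‖ ≤ ‖x - z x‖ + ‖x - w x‖ := by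
        simpa using norm_sub_le (x - z x) (x - w x)
      gcongr
    linarith
  · intro c w' hc y
    have h1 := hV' y w'
    have h2 := hU w'
    have hs : ε + δ ≠ 0 := by positivity
    set q := w' + (δ / (ε + δ)) • (ζ w' - w') with hq
    have h3 := hc q
    have h4 := hf' q (ζ w')
    have e1 : ‖q - w'‖ ^ 2 = (δ / (ε + δ)) ^ 2 * ‖w' - ζ w'‖ ^ 2 := by
      rw [hq, add_sub_cancel_left, norm_smul, mul_pow, Real.norm_eq_abs, sq_abs, norm_sub_rev]
    have e2 : ‖q - ζ w'‖ ^ 2 = (ε / (ε + δ)) ^ 2 * ‖w' - ζ w'‖ ^ 2 := by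
      have : q - ζ w' = (ε / (ε + δ)) • (w' - ζ w') := by
        have : ε / (ε + δ) = 1 - δ / (ε + δ) := by field_simp; ring
        rw [hq, this, sub_smul, one_smul, smul_sub, smul_sub]
        abel
      rw [this, norm_smul, mul_pow, Real.norm_eq_abs, sq_abs]
    rw [e1] at h3
    rw [e2] at h4
    have e3 : (δ / (ε + δ)) ^ 2 * ‖w' - ζ w'‖ ^ 2 / (2 * δ)
        + (ε / (ε + δ)) ^ 2 * ‖w' - ζ w'‖ ^ 2 / (2 * ε) = ‖w' - ζ w'‖ ^ 2 / (2 * (ε + δ)) := by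
      field_simp
      ring
    linarith

end Regularization

section Jets

variable {E : Type*} [NormedAddCommGroup E] [InnerProductSpace ℝ E]

/-- The pair `(p, B)` is a second-order expansion of `u` at `y` from above. -/
def JetAbove (u : E → ℝ) (y : E) (p : E →L[ℝ] ℝ) (B : E →L[ℝ] E →L[ℝ] ℝ) : Prop :=
  ∀ η > 0, ∀ᶠ k in 𝓝 (0 : E), u (y + k) ≤ u y + p k + 1 / 2 * B k k + η * ‖k‖ ^ 2

theorem envelope_add_le {f g h : E → ℝ} {ε δ κ m : ℝ} {p : E} (hδ : 0 < δ)
    (hεδ : 1 / (2 * δ) = 1 / (2 * ε) + κ)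
    (henv : ∀ (c : ℝ) (w : E), (∀ y, f y ≤ c + ‖y - w‖ ^ 2 / (2 * δ)) →
        ∀ y, g y ≤ c + ‖y - w‖ ^ 2 / (2 * δ))
    (hsub : ∀ y, ∃ v : E, ∀ k, h y + inner ℝ v k - ‖k‖ ^ 2 / (2 * ε) ≤ h (y + k))
    (hsum : ∀ y, f y + h y ≤ m + κ * ‖y - p‖ ^ 2) (y : E) :
    g y + h y ≤ m + κ * ‖y - p‖ ^ 2 := by
  obtain ⟨v, hv⟩ := hsub y
  set V : E := (2 * κ) • (y - p) - v with hV
  have e0 : ∀ k : E, ‖y + k - (y - δ • V)‖ ^ 2 / (2 * δ)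
      = ‖k‖ ^ 2 / (2 * δ) + inner ℝ V k + δ * ‖V‖ ^ 2 / 2 := by
    intro k
    rw [show y + k - (y - δ • V) = k + δ • V by abel, norm_add_sq_real, real_inner_smul_right,
      norm_smul, mul_pow, Real.norm_eq_abs, sq_abs, real_inner_comm]
    field_simp
  have h1 := henv (m + κ * ‖y - p‖ ^ 2 - h y - δ * ‖V‖ ^ 2 / 2) (y - δ • V) (by
    intro y'
    obtain ⟨k, rfl⟩ : ∃ k, y' = y + k := ⟨y' - y, by simp⟩
    rw [e0]
    have a1 := hsum (y + k)
    have a2 := hv k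
    have a3 : ‖y + k - p‖ ^ 2 = ‖y - p‖ ^ 2 + 2 * inner ℝ (y - p) k + ‖k‖ ^ 2 := by
      rw [show y + k - p = (y - p) + k by abel, norm_add_sq_real]
    have a4 : inner ℝ V k = 2 * κ * inner ℝ (y - p) k - inner ℝ v k := by
      rw [hV, inner_sub_left, real_inner_smul_left]
    have a5 : ‖k‖ ^ 2 / (2 * δ) = ‖k‖ ^ 2 / (2 * ε) + κ * ‖k‖ ^ 2 := by
      rw [div_eq_mul_one_div, hεδ]; ring
    rw [a3] at a1
    rw [a4, a5]
    linarith) y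
  have e1 := e0 0
  simp only [add_zero, norm_zero, inner_zero_right] at e1
  rw [e1] at h1
  norm_num at h1
  linarith

/-- At generic points the sup-convolutions of two functions whose penalised sum is maximal both
have second-order expansions; these transfer to the original functions. -/
theorem exists_common_jets [FiniteDimensional ℝ E] {u₁ u₂ : E → ℝ}
    (hu₁ : UpperSemicontinuous u₁) (hu₂ : UpperSemicontinuous u₂) {M : ℝ}
    (hM₁ : ∀ x, |u₁ x| ≤ M) (hM₂ : ∀ x, |u₂ x| ≤ M) {ε κ : ℝ} (hε : 0 < ε) (hκ : 0 < κ) :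
    ∃ (p x z₁ z₂ : E) (B₁ B₂ : E →L[ℝ] E →L[ℝ] ℝ), ‖p‖ ≤ 1 ∧
      (∀ k l, B₁ k l = B₁ l k) ∧ (∀ k l, B₂ k l = B₂ l k) ∧
      (∀ x' y₁ y₂, u₁ y₁ + u₂ y₂ - (‖x' - y₁‖ ^ 2 + ‖x' - y₂‖ ^ 2) / (2 * ε) - κ * ‖x' - p‖ ^ 2 ≤
        u₁ z₁ + u₂ z₂ - (‖x - z₁‖ ^ 2 + ‖x - z₂‖ ^ 2) / (2 * ε) - κ * ‖x - p‖ ^ 2) ∧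
      JetAbove u₁ z₁ (innerSL ℝ ((1 / ε) • (z₁ - x))) B₁ ∧
      JetAbove u₂ z₂ (innerSL ℝ ((1 / ε) • (z₂ - x))) B₂ ∧
      (∀ k, B₁ k k + B₂ k k ≤ 2 * κ * ‖k‖ ^ 2) ∧
      (1 / ε) • (z₁ - x) + (1 / ε) • (z₂ - x) = (2 * κ) • (x - p) := by
  borelize E
  set δ := ε / (1 + 2 * ε * κ) with hδdef
  have hδ : 0 < δ := by positivity
  have hεδ : 1 / (2 * δ) = 1 / (2 * ε) + κ := by
    rw [hδdef]; field_simp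
  obtain ⟨f₁, ζ₁, g₁, P₁, hf₁, hf₁', ha₁, hb₁, hc₁, hd₁⟩ := exists_regularization hu₁ hM₁ hε hδ
  obtain ⟨f₂, ζ₂, g₂, P₂, hf₂, hf₂', ha₂, hb₂, hc₂, hd₂⟩ := exists_regularization hu₂ hM₂ hε hδ
  have pin : ∀ {g : E → ℝ} {P : E → E →L[ℝ] ℝ},
      (∀ x k, g (x + k) ≤ g x + P x k + ‖k‖ ^ 2 / (2 * δ)) →
      (∀ x k, g x + P x k - ‖k‖ ^ 2 / (2 * ε) ≤ g (x + k)) →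
      ∀ x k, |g (x + k) - g x - P x k| ≤ 1 / (2 * δ) * ‖k‖ ^ 2 := by
    intro g P ha hb x k
    have h1 := ha x k
    have h2 := hb x k
    have h3 : ‖k‖ ^ 2 / (2 * δ) = 1 / (2 * δ) * ‖k‖ ^ 2 := by ring
    have h4 : ‖k‖ ^ 2 / (2 * ε) ≤ 1 / (2 * δ) * ‖k‖ ^ 2 := by
      rw [hεδ, add_mul, one_div_mul_eq_div]
      have : 0 ≤ κ * ‖k‖ ^ 2 := by positivity
      linarith
    rw [abs_le]
    constructor <;> linarith
  obtain ⟨hg₁, hL₁⟩ := hasFDerivAt_and_lipschitz_of_pinned (by positivity) (pin ha₁ hb₁)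
  obtain ⟨hg₂, hL₂⟩ := hasFDerivAt_and_lipschitz_of_pinned (by positivity) (pin ha₂ hb₂)
  set μ : MeasureTheory.Measure E :=
    MeasureTheory.Measure.hausdorffMeasure (Module.finrank ℝ E : ℝ) with hμ
  set bad : Set E := {x | ¬ (DifferentiableAt ℝ P₁ x ∧ DifferentiableAt ℝ P₂ x)} with hbad
  have hbad0 : μ bad = 0 := by
    have := (hL₁.ae_differentiableAt (μ := μ)).and (hL₂.ae_differentiableAt (μ := μ))
    exact MeasureTheory.ae_iff.1 this
  set G : E → E := fun x =>
    x - (1 / (2 * κ)) • (InnerProductSpace.toDual ℝ E).symm (P₁ x + P₂ x) with hG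
  obtain ⟨K, hGL⟩ : ∃ K, LipschitzWith K G := by
    have h1 := (InnerProductSpace.toDual ℝ E).symm.lipschitz.comp (hL₁.add hL₂)
    have h2 := (lipschitzWith_smul (1 / (2 * κ)) : LipschitzWith _ fun x : E => _).comp h1
    exact ⟨_, LipschitzWith.id.sub h2⟩
  have hGbad : μ (G '' bad) = 0 := by
    have := hGL.hausdorffMeasure_image_le (d := Module.finrank ℝ E) (by positivity) bad
    rw [← hμ, hbad0, mul_zero] at this
    exact le_antisymm this bot_le
  obtain ⟨p, hp, hpbad⟩ : ∃ p ∈ Metric.ball (0 : E) 1, p ∉ G '' bad := by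
    by_contra! hcon
    have h1 := MeasureTheory.measure_mono_null (fun p hp => hcon p hp) hGbad
    exact (Metric.measure_ball_pos μ (0 : E) one_pos).ne' h1
  set Ψ : E × E × E → ℝ := fun q => u₁ q.2.1 + u₂ q.2.2
    - (‖q.1 - q.2.1‖ ^ 2 + ‖q.1 - q.2.2‖ ^ 2) / (2 * ε) - κ * ‖q.1 - p‖ ^ 2 with hΨ
  have hΨusc : UpperSemicontinuous Ψ := by
    have h1 : UpperSemicontinuous fun q : E × E × E => u₁ q.2.1 :=
      hu₁.comp (by fun_prop)
    have h2 : UpperSemicontinuous fun q : E × E × E => u₂ q.2.2 :=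
      hu₂.comp (by fun_prop)
    have h3 : Continuous fun q : E × E × E =>
        -((‖q.1 - q.2.1‖ ^ 2 + ‖q.1 - q.2.2‖ ^ 2) / (2 * ε) + κ * ‖q.1 - p‖ ^ 2) := by fun_prop
    have h4 : Ψ = fun q : E × E × E => u₁ q.2.1 + u₂ q.2.2 +
        -((‖q.1 - q.2.1‖ ^ 2 + ‖q.1 - q.2.2‖ ^ 2) / (2 * ε) + κ * ‖q.1 - p‖ ^ 2) := by
      funext q
      simp only [hΨ]; ring
    rw [h4]
    exact (h1.add h2).add h3.upperSemicontinuous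
  obtain ⟨⟨x, z₁, z₂⟩, hmax⟩ : ∃ q, ∀ q', Ψ q' ≤ Ψ q := by
    refine hΨusc.exists_forall_le_of_cocompact (p, p, p) ?_
    have hM0 : 0 ≤ M := (abs_nonneg _).trans (hM₁ p)
    set R := 4 * M / κ + 1 with hR
    set R' := 8 * M * ε + 1 with hR'
    have hK : IsCompact (Metric.closedBall p R ×ˢ
        (Metric.closedBall p (R + R') ×ˢ Metric.closedBall p (R + R'))) :=
      (isCompact_closedBall _ _).prod ((isCompact_closedBall _ _).prod (isCompact_closedBall _ _))
    refine mem_cocompact.2 ⟨_, hK, ?_⟩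
    rintro ⟨x, y₁, y₂⟩ hq
    by_contra hcon
    refine hq ?_
    simp only [Set.mem_ofPred_eq, not_le, hΨ, sub_self, norm_zero] at hcon
    norm_num at hcon
    have b1 := abs_le.1 (hM₁ p)
    have b2 := abs_le.1 (hM₂ p)
    have b3 := abs_le.1 (hM₁ y₁)
    have b4 := abs_le.1 (hM₂ y₂)
    rw [add_div] at hcon
    have c1 : 0 ≤ ‖x - y₁‖ ^ 2 / (2 * ε) := by positivity
    have c2 : 0 ≤ ‖x - y₂‖ ^ 2 / (2 * ε) := by positivity
    have c3 : 0 ≤ κ * ‖x - p‖ ^ 2 := by positivity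
    have d1 : ‖x - p‖ ≤ R := by
      have h1 : ‖x - p‖ ^ 2 ≤ 4 * M / κ := by
        rw [le_div_iff₀ hκ]; linarith
      have h2 : 0 ≤ 4 * M / κ := by positivity
      nlinarith [norm_nonneg (x - p)]
    have d2 : ∀ y, ‖x - y‖ ^ 2 / (2 * ε) ≤ 4 * M → ‖y - p‖ ≤ R + R' := by
      intro y hy
      have h1 : ‖x - y‖ ^ 2 ≤ 8 * M * ε := by
        rw [div_le_iff₀ (by positivity)] at hy; linarith
      have h2 : ‖x - y‖ ≤ R' := by
        have h2 : 0 ≤ 8 * M * ε := by positivity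
        nlinarith [norm_nonneg (x - y)]
      have h3 : ‖y - p‖ ≤ ‖x - p‖ + ‖x - y‖ := by
        simpa using norm_sub_le (x - p) (x - y)
      linarith
    refine ⟨?_, ?_, ?_⟩
    · simpa [dist_eq_norm] using d1
    · simpa [dist_eq_norm] using d2 y₁ (by linarith)
    · simpa [dist_eq_norm] using d2 y₂ (by linarith)
  have hmax' : ∀ x' y₁ y₂, u₁ y₁ + u₂ y₂ - (‖x' - y₁‖ ^ 2 + ‖x' - y₂‖ ^ 2) / (2 * ε)
      - κ * ‖x' - p‖ ^ 2 ≤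
        u₁ z₁ + u₂ z₂ - (‖x - z₁‖ ^ 2 + ‖x - z₂‖ ^ 2) / (2 * ε) - κ * ‖x - p‖ ^ 2 :=
    fun x' y₁ y₂ => hmax (x', y₁, y₂)
  set m := u₁ z₁ + u₂ z₂ - (‖x - z₁‖ ^ 2 + ‖x - z₂‖ ^ 2) / (2 * ε) - κ * ‖x - p‖ ^ 2 with hm
  have hsplit : ∀ a b : ℝ, (a + b) / (2 * ε) = a / (2 * ε) + b / (2 * ε) := fun a b => add_div _ _ _
  have s0 : ∀ y, f₁ y + f₂ y ≤ m + κ * ‖y - p‖ ^ 2 := by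
    intro y
    have h1 := hmax' y (ζ₁ y) (ζ₂ y)
    rw [hsplit] at h1
    linarith [hf₁ y, hf₂ y]
  have sqx : ∀ x z k : E, ‖x + k - z‖ ^ 2 / (2 * ε)
      = ‖x - z‖ ^ 2 / (2 * ε) - inner ℝ ((1 / ε) • (z - x)) k + ‖k‖ ^ 2 / (2 * ε) := by
    intro x z k
    rw [show x + k - z = k - (z - x) by abel, norm_sub_sq_real, real_inner_smul_left,
      real_inner_comm, norm_sub_rev z x]
    field_simp
    ring
  have s1 : ∀ y, g₁ y + f₂ y ≤ m + κ * ‖y - p‖ ^ 2 := by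
    refine envelope_add_le hδ hεδ hd₁ (fun y => ⟨(1 / ε) • (ζ₂ y - y), fun k => ?_⟩) s0
    have h1 := hf₂' (y + k) (ζ₂ y)
    rw [sqx] at h1
    linarith [hf₂ y]
  have s2 : ∀ y, g₁ y + g₂ y ≤ m + κ * ‖y - p‖ ^ 2 := by
    intro y
    rw [add_comm]
    refine envelope_add_le hδ hεδ hd₂
      (fun y => ⟨(InnerProductSpace.toDual ℝ E).symm (P₁ y), fun k => ?_⟩)
      (fun y => by rw [add_comm]; exact s1 y) y
    rw [InnerProductSpace.toDual_symm_apply]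
    exact hb₁ y k
  have t1 := hf₁' x z₁
  have t2 := hf₂' x z₂
  have t3 := s2 x
  have t4 := hc₁ x
  have t5 := hc₂ x
  rw [hsplit] at hm
  have q1 : g₁ x = u₁ z₁ - ‖x - z₁‖ ^ 2 / (2 * ε) := by linarith
  have q2 : g₂ x = u₂ z₂ - ‖x - z₂‖ ^ 2 / (2 * ε) := by linarith
  have hgrad : ∀ {u f g : E → ℝ} {P : E → E →L[ℝ] ℝ} {z : E},
      (∀ x y, u y - ‖x - y‖ ^ 2 / (2 * ε) ≤ f x) → (∀ x, f x ≤ g x) →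
      (∀ x k, g (x + k) ≤ g x + P x k + ‖k‖ ^ 2 / (2 * δ)) →
      g x = u z - ‖x - z‖ ^ 2 / (2 * ε) → P x = innerSL ℝ ((1 / ε) • (z - x)) := by
    intro u f g P z hf' hc ha hq
    have : innerSL ℝ ((1 / ε) • (z - x)) - P x = 0 := by
      refine clm_eq_zero_of_le_sq (C := 1 / (2 * δ) + 1 / (2 * ε)) (Eventually.of_forall fun k => ?_)
      have h1 := hf' (x + k) z
      rw [sqx] at h1
      have h2 := ha x k
      have h3 := hc (x + k)
      have h4 : (1 / (2 * δ) + 1 / (2 * ε)) * ‖k‖ ^ 2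
        = ‖k‖ ^ 2 / (2 * δ) + ‖k‖ ^ 2 / (2 * ε) := by ring
      rw [h4, _root_.sub_apply, innerSL_apply_apply]
      linarith
    exact (sub_eq_zero.1 this).symm
  have hP₁ := hgrad hf₁' hc₁ ha₁ q1
  have hP₂ := hgrad hf₂' hc₂ ha₂ q2
  have sqp : ∀ k : E, κ * ‖x + k - p‖ ^ 2
      = κ * ‖x - p‖ ^ 2 + inner ℝ ((2 * κ) • (x - p)) k + κ * ‖k‖ ^ 2 := by
    intro k
    rw [show x + k - p = (x - p) + k by abel, norm_add_sq_real, real_inner_smul_left]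
    ring
  have hPsum : P₁ x + P₂ x = innerSL ℝ ((2 * κ) • (x - p)) := by
    refine sub_eq_zero.1 (clm_eq_zero_of_le_sq (C := 1 / (2 * ε) + 1 / (2 * ε) + κ)
      (Eventually.of_forall fun k => ?_))
    have h1 := hb₁ x k
    have h2 := hb₂ x k
    have h3 := s2 (x + k)
    rw [sqp] at h3
    have h4 : (1 / (2 * ε) + 1 / (2 * ε) + κ) * ‖k‖ ^ 2
        = ‖k‖ ^ 2 / (2 * ε) + ‖k‖ ^ 2 / (2 * ε) + κ * ‖k‖ ^ 2 := by ring
    rw [h4, _root_.sub_apply, _root_.add_apply, innerSL_apply_apply]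
    linarith
  have hvec : (1 / ε) • (z₁ - x) + (1 / ε) • (z₂ - x) = (2 * κ) • (x - p) := by
    refine ext_inner_right ℝ fun k => ?_
    have := congrArg (fun ℓ : E →L[ℝ] ℝ => ℓ k) hPsum
    rw [hP₁, hP₂] at this
    simpa only [_root_.add_apply, innerSL_apply_apply, inner_add_left] using this
  have hGx : G x = p := by
    have : (InnerProductSpace.toDual ℝ E).symm (P₁ x + P₂ x) = (2 * κ) • (x - p) := by
      rw [LinearIsometryEquiv.symm_apply_eq, hPsum]
      ext k; simp
    simp only [hG]
    rw [this, smul_smul, one_div_mul_cancel (by positivity), one_smul, sub_sub_cancel]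
  have hgood : DifferentiableAt ℝ P₁ x ∧ DifferentiableAt ℝ P₂ x := by
    by_contra hcon
    exact hpbad ⟨x, hcon, hGx⟩
  have hS₁ := second_derivative_symmetric hg₁ hgood.1.hasFDerivAt
  have hS₂ := second_derivative_symmetric hg₂ hgood.2.hasFDerivAt
  have hT₁ := fun η (hη : (0 : ℝ) < η) =>
    taylor_second_order hg₁ hgood.1.hasFDerivAt hS₁ hη
  have hT₂ := fun η (hη : (0 : ℝ) < η) =>
    taylor_second_order hg₂ hgood.2.hasFDerivAt hS₂ hη
  have hjet : ∀ {u f g : E → ℝ} {P : E → E →L[ℝ] ℝ} {B : E →L[ℝ] E →L[ℝ] ℝ} {z : E},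
      (∀ x y, u y - ‖x - y‖ ^ 2 / (2 * ε) ≤ f x) → (∀ x, f x ≤ g x) →
      (∀ η > 0, ∀ᶠ k in 𝓝 (0 : E), |g (x + k) - g x - P x k - 1 / 2 * B k k| ≤ η * ‖k‖ ^ 2) →
      g x = u z - ‖x - z‖ ^ 2 / (2 * ε) → JetAbove u z (P x) B := by
    intro u f g P B z hf' hc hT hq η hη
    filter_upwards [hT η hη] with k hk
    have h1 := hf' (x + k) (z + k)
    rw [add_sub_add_right_eq_sub] at h1
    linarith [hc (x + k), (abs_le.1 hk).2]
  refine ⟨p, x, z₁, z₂, fderiv ℝ P₁ x, fderiv ℝ P₂ x, ?_, hS₁, hS₂, hmax', ?_, ?_, ?_, hvec⟩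
  · exact (by simpa using hp : ‖p‖ < 1).le
  · rw [← hP₁]; exact hjet hf₁' hc₁ hT₁ q1
  · rw [← hP₂]; exact hjet hf₂' hc₂ hT₂ q2
  · intro k
    refine bilin_le_of_eventually (B := fderiv ℝ P₁ x + fderiv ℝ P₂ x) (fun η hη => ?_) k
    filter_upwards [hT₁ (η / 4) (by positivity), hT₂ (η / 4) (by positivity)] with k hk1 hk2
    have h3 := s2 (x + k)
    rw [sqp] at h3
    have h4 := congrArg (fun ℓ : E →L[ℝ] ℝ => ℓ k) hPsum
    simp only [_root_.add_apply, innerSL_apply_apply] at h4 ⊢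
    linarith [(abs_le.1 hk1).1, (abs_le.1 hk2).1]

end Jets

section Comparison

variable {E : Type*} [NormedAddCommGroup E]

/-- Supremum of the doubled functional with penalisation parameter `ε`. -/
def penalizedSup (u₁ u₂ : E → ℝ) (ε : ℝ) : ℝ :=
  ⨆ q : E × E × E, (u₁ q.2.1 + u₂ q.2.2 - (‖q.1 - q.2.1‖ ^ 2 + ‖q.1 - q.2.2‖ ^ 2) / (2 * ε))

theorem bddAbove_penalized {u₁ u₂ : E → ℝ} {M : ℝ} (hM₁ : ∀ x, |u₁ x| ≤ M)
    (hM₂ : ∀ x, |u₂ x| ≤ M) {ε : ℝ} (hε : 0 < ε) :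
    BddAbove (range fun q : E × E × E =>
      u₁ q.2.1 + u₂ q.2.2 - (‖q.1 - q.2.1‖ ^ 2 + ‖q.1 - q.2.2‖ ^ 2) / (2 * ε)) := by
  refine ⟨2 * M, ?_⟩
  rintro _ ⟨q, rfl⟩
  have h1 := (abs_le.1 (hM₁ q.2.1)).2
  have h2 := (abs_le.1 (hM₂ q.2.2)).2
  have h3 : 0 ≤ (‖q.1 - q.2.1‖ ^ 2 + ‖q.1 - q.2.2‖ ^ 2) / (2 * ε) := by positivity
  dsimp only
  linarith

theorem le_penalizedSup {u₁ u₂ : E → ℝ} {M : ℝ} (hM₁ : ∀ x, |u₁ x| ≤ M)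
    (hM₂ : ∀ x, |u₂ x| ≤ M) {ε : ℝ} (hε : 0 < ε) (x y₁ y₂ : E) :
    u₁ y₁ + u₂ y₂ - (‖x - y₁‖ ^ 2 + ‖x - y₂‖ ^ 2) / (2 * ε) ≤ penalizedSup u₁ u₂ ε :=
  le_ciSup (bddAbove_penalized hM₁ hM₂ hε) (x, y₁, y₂)

variable [InnerProductSpace ℝ E]

/-- `u` satisfies `G(D²u) - (1/2) y·Du ≤ v` in the sense of second-order expansions. -/
def JetSubsolution (G : (E →L[ℝ] E →L[ℝ] ℝ) → ℝ) (v u : E → ℝ) : Prop :=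
  ∀ (y : E) (p : E →L[ℝ] ℝ) (B : E →L[ℝ] E →L[ℝ] ℝ), (∀ k l, B k l = B l k) →
    JetAbove u y p B → G B - 1 / 2 * p y ≤ v y

theorem exists_penalized_points [FiniteDimensional ℝ E] {u₁ u₂ v₁ v₂ : E → ℝ}
    {G₁ G₂ : (E →L[ℝ] E →L[ℝ] ℝ) → ℝ} {C M : ℝ} (hC : 0 ≤ C)
    (hu₁ : UpperSemicontinuous u₁) (hu₂ : UpperSemicontinuous u₂)
    (hM₁ : ∀ x, |u₁ x| ≤ M) (hM₂ : ∀ x, |u₂ x| ≤ M)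
    (hG : ∀ B₁ B₂ : E →L[ℝ] E →L[ℝ] ℝ, (∀ k l, B₁ k l = B₁ l k) → (∀ k l, B₂ k l = B₂ l k) →
      ∀ c, 0 ≤ c → (∀ k, B₁ k k + B₂ k k ≤ c * ‖k‖ ^ 2) → -(C * c) ≤ G₁ B₁ + G₂ B₂)
    (hs₁ : JetSubsolution G₁ v₁ u₁) (hs₂ : JetSubsolution G₂ v₂ u₂) {ε : ℝ} (hε : 0 < ε) :
    ∃ z₁ z₂ : E, penalizedSup u₁ u₂ ε - ε ≤ u₁ z₁ + u₂ z₂ ∧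
      ‖z₁ - z₂‖ ^ 2 ≤ 8 * ε * (penalizedSup u₁ u₂ (2 * ε) - penalizedSup u₁ u₂ ε + ε) ∧
      -(2 * C * ε + 2 * (penalizedSup u₁ u₂ (2 * ε) - penalizedSup u₁ u₂ ε + ε) + 3 * ε)
        ≤ v₁ z₁ + v₂ z₂ := by
  obtain ⟨⟨x₀, a₁, a₂⟩, hq⟩ := exists_lt_of_lt_ciSup
    (show penalizedSup u₁ u₂ ε - ε / 2 < penalizedSup u₁ u₂ ε by linarith)
  dsimp only at hq
  set κ := min ε (ε / (2 * (‖x₀‖ + 1) ^ 2)) with hκdef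
  have hκ : 0 < κ := by positivity
  have hκε : κ ≤ ε := min_le_left _ _
  have hκ2 : κ * (‖x₀‖ + 1) ^ 2 ≤ ε / 2 := by
    calc κ * (‖x₀‖ + 1) ^ 2 ≤ (ε / (2 * (‖x₀‖ + 1) ^ 2)) * (‖x₀‖ + 1) ^ 2 := by
          gcongr; exact min_le_right _ _
      _ = ε / 2 := by field_simp
  obtain ⟨p, x, z₁, z₂, B₁, B₂, hp, hS₁, hS₂, hmax, hJ₁, hJ₂, hB, hvec⟩ :=
    exists_common_jets hu₁ hu₂ hM₁ hM₂ hε hκ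
  have h1 := hmax x₀ a₁ a₂
  have h2 : κ * ‖x₀ - p‖ ^ 2 ≤ ε / 2 := by
    refine le_trans ?_ hκ2
    have : ‖x₀ - p‖ ≤ ‖x₀‖ + 1 := (norm_sub_le _ _).trans (by linarith)
    gcongr
  have h3 := le_penalizedSup hM₁ hM₂ hε x z₁ z₂
  have h4 := le_penalizedSup hM₁ hM₂ (by positivity : 0 < 2 * ε) x z₁ z₂
  set N := penalizedSup u₁ u₂ ε
  set N' := penalizedSup u₁ u₂ (2 * ε)
  set D := ‖x - z₁‖ ^ 2 + ‖x - z₂‖ ^ 2 with hD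
  have hD0 : 0 ≤ D := by positivity
  have h5 : D / (2 * ε) = 2 * (D / (4 * ε)) := by field_simp; norm_num
  have h6 : D / (2 * (2 * ε)) = D / (4 * ε) := by ring_nf
  have h7 : 0 ≤ D / (4 * ε) := by positivity
  have h8 : 0 ≤ κ * ‖x - p‖ ^ 2 := by positivity
  rw [h6] at h4
  rw [h5] at h1 h3
  have hDe : D / (4 * ε) ≤ N' - N + ε := by linarith
  have hκp : κ * ‖x - p‖ ^ 2 ≤ ε := by linarith
  refine ⟨z₁, z₂, by linarith, ?_, ?_⟩
  · rw [div_le_iff₀ (by positivity)] at hDe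
    have : ‖z₁ - z₂‖ ≤ ‖x - z₁‖ + ‖x - z₂‖ := by
      have := norm_sub_le (x - z₂) (x - z₁)
      rw [show x - z₂ - (x - z₁) = z₁ - z₂ by abel] at this
      linarith
    have h9 : ‖z₁ - z₂‖ ^ 2 ≤ (‖x - z₁‖ + ‖x - z₂‖) ^ 2 := by gcongr
    nlinarith [sq_nonneg (‖x - z₁‖ - ‖x - z₂‖)]
  · have k1 := hs₁ z₁ _ B₁ hS₁ hJ₁
    have k2 := hs₂ z₂ _ B₂ hS₂ hJ₂
    have k3 := hG B₁ B₂ hS₁ hS₂ (2 * κ) (by positivity) hB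
    rw [innerSL_apply_apply] at k1 k2
    have k4 : inner ℝ ((1 / ε) • (z₁ - x)) z₁ + inner ℝ ((1 / ε) • (z₂ - x)) z₂
        = 4 * (D / (4 * ε)) + 2 * κ * ‖x - p‖ ^ 2 + 2 * κ * inner ℝ (x - p) p := by
      have e1 : ∀ z : E, inner ℝ ((1 / ε) • (z - x)) z
          = ‖x - z‖ ^ 2 / ε + inner ℝ ((1 / ε) • (z - x)) x := by
        intro z
        rw [real_inner_smul_left, real_inner_smul_left, norm_sub_rev,
          ← real_inner_self_eq_norm_sq, inner_sub_right]
        ring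
      rw [e1 z₁, e1 z₂]
      have e2 := congrArg (fun w => inner ℝ w x) hvec
      simp only [inner_add_left] at e2
      have e3 : inner ℝ ((2 * κ) • (x - p)) x
          = 2 * κ * ‖x - p‖ ^ 2 + 2 * κ * inner ℝ (x - p) p := by
        rw [real_inner_smul_left, ← real_inner_self_eq_norm_sq, inner_sub_right]
        ring
      have e4 : 4 * (D / (4 * ε)) = ‖x - z₁‖ ^ 2 / ε + ‖x - z₂‖ ^ 2 / ε := by
        rw [hD]; field_simp
      linarith
    have k5 : κ * inner ℝ (x - p) p ≤ 2 * ε := by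
      have f1 : inner ℝ (x - p) p ≤ ‖x - p‖ * ‖p‖ := real_inner_le_norm _ _
      have f2 : ‖x - p‖ * ‖p‖ ≤ ‖x - p‖ := mul_le_of_le_one_right (norm_nonneg _) hp
      have f3 : ‖x - p‖ ≤ ‖x - p‖ ^ 2 + 1 := by nlinarith [sq_nonneg (‖x - p‖ - 1), norm_nonneg (x - p)]
      calc κ * inner ℝ (x - p) p ≤ κ * (‖x - p‖ ^ 2 + 1) := by gcongr; linarith
        _ ≤ 2 * ε := by linarith
    have k6 : C * (2 * κ) ≤ 2 * C * ε := by nlinarith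
    linarith

/-- Comparison principle for a strict subsolution and a supersolution (written as `-u₂`) that
are ordered at infinity. -/
theorem JetSubsolution.add_nonpos [FiniteDimensional ℝ E] {u₁ u₂ v₁ v₂ : E → ℝ}
    {G₁ G₂ : (E →L[ℝ] E →L[ℝ] ℝ) → ℝ} {C M : ℝ} (hC : 0 ≤ C)
    (hs₁ : JetSubsolution G₁ v₁ u₁) (hs₂ : JetSubsolution G₂ v₂ u₂)
    (hu₁ : UpperSemicontinuous u₁) (hu₂ : UpperSemicontinuous u₂)
    (hM₁ : ∀ x, |u₁ x| ≤ M) (hM₂ : ∀ x, |u₂ x| ≤ M)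
    (hG : ∀ B₁ B₂ : E →L[ℝ] E →L[ℝ] ℝ, (∀ k l, B₁ k l = B₁ l k) → (∀ k l, B₂ k l = B₂ l k) →
      ∀ c, 0 ≤ c → (∀ k, B₁ k k + B₂ k k ≤ c * ‖k‖ ^ 2) → -(C * c) ≤ G₁ B₁ + G₂ B₂)
    (hi₁ : ∀ η > 0, ∀ᶠ x in cocompact E, u₁ x ≤ η) (hi₂ : ∀ η > 0, ∀ᶠ x in cocompact E, u₂ x ≤ η)
    (hv₁ : Continuous v₁) (hv₂ : Continuous v₂) (hv : ∀ x, v₁ x + v₂ x < 0) (x : E) :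
    u₁ x + u₂ x ≤ 0 := by
  by_contra! hθ
  set θ := u₁ x + u₂ x with hθdef
  set N := penalizedSup u₁ u₂ with hN
  have hNθ : ∀ ε > 0, θ ≤ N ε := by
    intro ε hε
    have := le_penalizedSup hM₁ hM₂ hε x x x
    simpa using this
  set e : ℕ → ℝ := fun k => (1 / 2) ^ k with he
  have hepos : ∀ k, 0 < e k := fun k => by positivity
  have he0 : Tendsto e atTop (𝓝 0) :=
    tendsto_pow_atTop_nhds_zero_of_lt_one (by norm_num) (by norm_num)
  have hesucc : ∀ k, 2 * e (k + 1) = e k := fun k => by simp [he, pow_succ]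
  have hanti : Antitone fun k => N (e k) := by
    refine antitone_nat_of_succ_le fun k => ?_
    refine ciSup_le fun q => (le_trans ?_ (le_penalizedSup hM₁ hM₂ (hepos k) q.1 q.2.1 q.2.2))
    have : e (k + 1) ≤ e k := by linarith [hesucc k, hepos (k + 1)]
    have h3 := hepos (k + 1)
    gcongr
  obtain ⟨l, hl⟩ : ∃ l, Tendsto (fun k => N (e k)) atTop (𝓝 l) :=
    ⟨_, tendsto_atTop_ciInf hanti ⟨θ, by rintro _ ⟨k, rfl⟩; exact hNθ _ (hepos k)⟩⟩
  set r : ℕ → ℝ := fun k => N (e k) - N (e (k + 1)) + e (k + 1) with hr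
  have he1 : Tendsto (fun k => e (k + 1)) atTop (𝓝 0) := he0.comp (tendsto_add_atTop_nat 1)
  have hr0 : Tendsto r atTop (𝓝 0) := by
    have := (hl.sub (hl.comp (tendsto_add_atTop_nat 1))).add he1
    simpa using this
  have hpts : ∀ k, ∃ z₁ z₂ : E, θ - e (k + 1) ≤ u₁ z₁ + u₂ z₂ ∧
      ‖z₁ - z₂‖ ^ 2 ≤ 8 * e (k + 1) * r k ∧
      -(2 * C * e (k + 1) + 2 * r k + 3 * e (k + 1)) ≤ v₁ z₁ + v₂ z₂ := by
    intro k
    obtain ⟨z₁, z₂, h1, h2, h3⟩ :=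
      exists_penalized_points hC hu₁ hu₂ hM₁ hM₂ hG hs₁ hs₂ (hepos (k + 1))
    rw [hesucc] at h2 h3
    exact ⟨z₁, z₂, by linarith [hNθ _ (hepos (k + 1))], h2, h3⟩
  choose z₁ z₂ hz1 hz2 hz3 using hpts
  have hdist : Tendsto (fun k => ‖z₁ k - z₂ k‖) atTop (𝓝 0) := by
    have h1 : Tendsto (fun k => 8 * e (k + 1) * r k) atTop (𝓝 0) := by
      simpa using (he1.const_mul 8).mul hr0
    have h2 : Tendsto (fun k => ‖z₁ k - z₂ k‖ ^ 2) atTop (𝓝 0) :=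
      squeeze_zero (fun k => by positivity) hz2 h1
    have h3 := h2.sqrt
    simpa [Real.sqrt_sq] using h3
  obtain ⟨K, hK, hKsub⟩ := mem_cocompact.1 ((hi₁ (θ / 8) (by positivity)).and
    (hi₂ (θ / 8) (by positivity)))
  obtain ⟨R, hR⟩ := hK.isBounded.subset_closedBall (0 : E)
  have hbd : ∀ᶠ k in atTop, z₁ k ∈ Metric.closedBall (0 : E) (R + 1) := by
    filter_upwards [hdist.eventually_lt_const one_pos,
      he1.eventually_lt_const (show 0 < θ / 2 by positivity)] with k hk1 hk2
    have h1 := hz1 k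
    by_cases c1 : z₁ k ∈ K
    · exact Metric.closedBall_subset_closedBall (by linarith) (hR c1)
    by_cases c2 : z₂ k ∈ K
    · have := hR c2
      rw [mem_closedBall_zero_iff] at this ⊢
      have h2 : ‖z₁ k‖ ≤ ‖z₂ k‖ + ‖z₁ k - z₂ k‖ := by
        simpa using norm_add_le (z₂ k) (z₁ k - z₂ k)
      linarith
    · have h2 : u₁ (z₁ k) ≤ θ / 8 := (hKsub c1).1
      have h3 : u₂ (z₂ k) ≤ θ / 8 := (hKsub c2).2
      linarith
  obtain ⟨a, -, φ, hφ, ha⟩ := (isCompact_closedBall (0 : E) (R + 1)).tendsto_subseq' hbd.frequently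
  have ha2 : Tendsto (z₂ ∘ φ) atTop (𝓝 a) := by
    have h0 : Tendsto (fun k => z₁ (φ k) - z₂ (φ k)) atTop (𝓝 0) :=
      tendsto_zero_iff_norm_tendsto_zero.2 (hdist.comp hφ.tendsto_atTop)
    have h1 := ha.sub h0
    simpa [Function.comp_def] using h1
  have hlim : Tendsto (fun k => v₁ (z₁ (φ k)) + v₂ (z₂ (φ k))) atTop (𝓝 (v₁ a + v₂ a)) :=
    ((hv₁.tendsto a).comp ha).add ((hv₂.tendsto a).comp ha2)
  have hlow : Tendsto (fun k => -(2 * C * e (φ k + 1) + 2 * r (φ k) + 3 * e (φ k + 1))) atTop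
      (𝓝 0) := by
    have h1 := ((he1.const_mul (2 * C)).add (hr0.const_mul 2)).add (he1.const_mul 3)
    have h2 := (h1.comp hφ.tendsto_atTop).neg
    simpa [Function.comp_def] using h2
  have := le_of_tendsto_of_tendsto' hlow hlim fun k => hz3 (φ k)
  linarith [hv a]

end Comparison

section Ellipticity

/-- The matrix of a bilinear form on `ℝⁿ` in the standard basis. -/
def formMatrix (n : ℕ) (B : En n →L[ℝ] En n →L[ℝ] ℝ) : Mat n :=
  Matrix.of fun i j => B (EuclideanSpace.single i 1) (EuclideanSpace.single j 1)

variable {n : ℕ}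

theorem formMatrix_isSymm {B : En n →L[ℝ] En n →L[ℝ] ℝ} (hB : ∀ k l, B k l = B l k) :
    (formMatrix n B).IsSymm :=
  Matrix.ext fun _ _ => hB _ _

theorem apply_self_eq_sum (B : En n →L[ℝ] En n →L[ℝ] ℝ) (x : En n) :
    B x x = ∑ i, ∑ j, x i * x j * formMatrix n B i j := by
  have hx := (EuclideanSpace.basisFun (Fin n) ℝ).sum_repr x
  simp only [EuclideanSpace.basisFun_repr, EuclideanSpace.basisFun_apply] at hx
  conv_lhs => rw [← hx]
  simp only [map_sum, map_smul, FunLike.coe_sum, Finset.sum_apply,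
    FunLike.coe_smul, Pi.smul_apply, smul_eq_mul, formMatrix, Matrix.of_apply,
    Finset.mul_sum]
  rw [Finset.sum_comm]
  refine Finset.sum_congr rfl fun i _ => Finset.sum_congr rfl fun j _ => ?_
  ring

theorem trace_mul_formMatrix {A : Mat n} (hA : A.IsHermitian) (B : En n →L[ℝ] En n →L[ℝ] ℝ) :
    (A * formMatrix n B).trace
      = ∑ i, hA.eigenvalues i * B (hA.eigenvectorBasis i) (hA.eigenvectorBasis i) := by
  have hent : ∀ j k, A j k = ∑ i, hA.eigenvalues i *
      (hA.eigenvectorBasis i j * hA.eigenvectorBasis i k) := by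
    intro j k
    conv_lhs => rw [hA.spectral_theorem, Unitary.conjStarAlgAut_apply]
    rw [Matrix.mul_apply]
    refine Finset.sum_congr rfl fun i _ => ?_
    rw [Matrix.mul_diagonal, Matrix.star_apply, hA.eigenvectorUnitary_apply,
      hA.eigenvectorUnitary_apply]
    simp only [Function.comp_apply, RCLike.ofReal_real_eq_id, id_eq, star_trivial]
    ring
  simp only [apply_self_eq_sum, Finset.mul_sum]
  rw [Matrix.trace]
  simp only [Matrix.diag_apply, Matrix.mul_apply, hent, Finset.sum_mul]
  calc _ = ∑ x, ∑ i, ∑ y, hA.eigenvalues i * (hA.eigenvectorBasis i x * hA.eigenvectorBasis i y)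
        * formMatrix n B y x := by
        refine Finset.sum_congr rfl fun x _ => Finset.sum_comm
    _ = ∑ i, ∑ x, ∑ y, hA.eigenvalues i * (hA.eigenvectorBasis i x * hA.eigenvectorBasis i y)
        * formMatrix n B y x := Finset.sum_comm
    _ = _ := by
        refine Finset.sum_congr rfl fun i _ => ?_
        rw [Finset.sum_comm]
        refine Finset.sum_congr rfl fun x _ => Finset.sum_congr rfl fun y _ => ?_
        ring

variable {lam Lam : ℝ}

theorem pucciMatrices_nonempty (n : ℕ) (h : lam ≤ Lam) : (PucciMatrices n lam Lam).Nonempty := by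
  have hA : ((lam • (1 : Mat n))).IsHermitian := by
    simp [Matrix.IsHermitian]
  refine ⟨_, hA, fun i => ?_⟩
  have h1 := hA.mulVec_eigenvectorBasis i
  have h2 : hA.eigenvalues i = lam := by
    have h3 : lam • (hA.eigenvectorBasis i) = hA.eigenvalues i • hA.eigenvectorBasis i := by
      ext j
      have := congrFun h1 j
      simpa [Matrix.smul_mulVec, Matrix.one_mulVec] using this
    have h4 := hA.eigenvectorBasis.orthonormal.ne_zero i
    exact (smul_left_injective ℝ h4 h3).symm
  rw [h2]
  exact ⟨le_rfl, h⟩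

theorem UniformlyElliptic.sub_le_of_trace_le {F : Mat n → ℝ} (hF : UniformlyElliptic n lam Lam F)
    (h : lam ≤ Lam) {M N : Mat n} (hM : M.IsSymm) (hN : N.IsSymm) {T : ℝ}
    (hT : ∀ A ∈ PucciMatrices n lam Lam, -(A * (M - N)).trace ≤ T) : F M - F N ≤ T := by
  refine (hF M N hM hN).2.trans (csSup_le ((pucciMatrices_nonempty n h).image _) ?_)
  rintro _ ⟨A, hA, rfl⟩
  exact hT A hA

theorem formMatrix_sub (B₁ B₂ : En n →L[ℝ] En n →L[ℝ] ℝ) :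
    formMatrix n B₁ - formMatrix n B₂ = formMatrix n (B₁ - B₂) := rfl

theorem UniformlyElliptic.le_add_of_le {F : Mat n → ℝ} (hF : UniformlyElliptic n lam Lam F)
    (hlam : 0 < lam) (h : lam ≤ Lam) {B₁ B₂ : En n →L[ℝ] En n →L[ℝ] ℝ}
    (h₁ : ∀ k l, B₁ k l = B₁ l k) (h₂ : ∀ k l, B₂ k l = B₂ l k) {c : ℝ} (hc : 0 ≤ c)
    (hB : ∀ k, B₁ k k ≤ B₂ k k + c * ‖k‖ ^ 2) :
    F (formMatrix n B₂) ≤ F (formMatrix n B₁) + n * Lam * c := by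
  rw [← sub_le_iff_le_add']
  refine hF.sub_le_of_trace_le h (formMatrix_isSymm h₂) (formMatrix_isSymm h₁) ?_
  rintro A ⟨hA, hAe⟩
  rw [formMatrix_sub, trace_mul_formMatrix hA, ← Finset.sum_neg_distrib]
  calc _ ≤ ∑ _i : Fin n, Lam * c := Finset.sum_le_sum fun i _ => ?_
    _ = n * Lam * c := by simp [mul_assoc]
  have h1 := hB (hA.eigenvectorBasis i)
  rw [hA.eigenvectorBasis.orthonormal.1 i] at h1
  have h2 := hAe i
  have h3 : -(B₂ - B₁) (hA.eigenvectorBasis i) (hA.eigenvectorBasis i) ≤ c := by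
    simp only [_root_.sub_apply]; linarith
  calc _ = hA.eigenvalues i * -(B₂ - B₁) (hA.eigenvectorBasis i) (hA.eigenvectorBasis i) := by ring
    _ ≤ hA.eigenvalues i * c := mul_le_mul_of_nonneg_left h3 (hlam.le.trans h2.1)
    _ ≤ Lam * c := mul_le_mul_of_nonneg_right h2.2 hc

theorem UniformlyElliptic.sub_le_of_le_inner {F : Mat n → ℝ} (hF : UniformlyElliptic n lam Lam F)
    (h : lam ≤ Lam) {B₁ B₂ : En n →L[ℝ] En n →L[ℝ] ℝ}
    (h₁ : ∀ k l, B₁ k l = B₁ l k) (h₂ : ∀ k l, B₂ k l = B₂ l k) {α β : ℝ} (hlam : 0 < lam)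
    (hα : 0 ≤ α) (hβ : 0 ≤ β) (y : En n)
    (hB : ∀ k, B₂ k k ≤ B₁ k k + α * inner ℝ y k ^ 2 - β * ‖k‖ ^ 2) :
    F (formMatrix n B₁) - α * Lam * ‖y‖ ^ 2 + β * lam * n ≤ F (formMatrix n B₂) := by
  have : F (formMatrix n B₁) - F (formMatrix n B₂) ≤ α * Lam * ‖y‖ ^ 2 - β * lam * n := by
    refine hF.sub_le_of_trace_le h (formMatrix_isSymm h₁) (formMatrix_isSymm h₂) ?_
    rintro A ⟨hA, hAe⟩
    rw [formMatrix_sub, trace_mul_formMatrix hA, ← Finset.sum_neg_distrib]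
    have hpars := hA.eigenvectorBasis.sum_sq_norm_inner_left y
    calc _ ≤ ∑ i : Fin n, (α * Lam * ‖inner ℝ y (hA.eigenvectorBasis i)‖ ^ 2 - β * lam) :=
          Finset.sum_le_sum fun i _ => ?_
      _ = α * Lam * ‖y‖ ^ 2 - β * lam * n := by
          rw [Finset.sum_sub_distrib, ← Finset.mul_sum, hpars]
          simp only [Finset.sum_const, Finset.card_univ, Fintype.card_fin, nsmul_eq_mul]
          ring
    have h1 := hB (hA.eigenvectorBasis i)
    rw [hA.eigenvectorBasis.orthonormal.1 i] at h1
    obtain ⟨h2, h3⟩ := hAe i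
    simp only [_root_.sub_apply, Real.norm_eq_abs, sq_abs]
    set μ := hA.eigenvalues i
    set q := inner ℝ y (hA.eigenvectorBasis i)
    have hμ : 0 ≤ μ := hlam.le.trans h2
    calc _ = μ * (B₂ (hA.eigenvectorBasis i) (hA.eigenvectorBasis i)
          - B₁ (hA.eigenvectorBasis i) (hA.eigenvectorBasis i)) := by ring
      _ ≤ μ * (α * q ^ 2 - β) := mul_le_mul_of_nonneg_left (by linarith) hμ
      _ = μ * (α * q ^ 2) - μ * β := by ring
      _ ≤ Lam * (α * q ^ 2) - lam * β := by gcongr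
      _ = _ := by ring
  linarith

end Ellipticity

section JetCalculus

variable {E : Type*} [NormedAddCommGroup E] [InnerProductSpace ℝ E]

/-- The inner product as a continuous bilinear form. -/
def innerForm (E : Type*) [NormedAddCommGroup E] [InnerProductSpace ℝ E] : E →L[ℝ] E →L[ℝ] ℝ :=
  innerSL ℝ

@[simp] theorem innerForm_apply (x y : E) : innerForm E x y = inner ℝ x y := rfl

theorem JetAbove.add {u u' : E → ℝ} {y : E} {p p' : E →L[ℝ] ℝ} {B B' : E →L[ℝ] E →L[ℝ] ℝ}
    (h : JetAbove u y p B) (h' : JetAbove u' y p' B') :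
    JetAbove (fun z => u z + u' z) y (p + p') (B + B') := by
  intro η hη
  filter_upwards [h (η / 2) (by positivity), h' (η / 2) (by positivity)] with k h1 h2
  simp only [_root_.add_apply]
  linarith

theorem JetAbove.mono {u u' : E → ℝ} {y : E} {p : E →L[ℝ] ℝ} {B : E →L[ℝ] E →L[ℝ] ℝ}
    (h : JetAbove u y p B) (heq : u' y = u y) (hle : ∀ᶠ k in 𝓝 (0 : E), u' (y + k) ≤ u (y + k)) :
    JetAbove u' y p B := by
  intro η hη
  filter_upwards [h η hη, hle] with k h1 h2
  rw [heq]
  exact h2.trans h1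

theorem JetAbove.of_isLocalMin {f : E → ℝ} {y : E} {p : E →L[ℝ] ℝ} {B : E →L[ℝ] E →L[ℝ] ℝ}
    (h : JetAbove f y p B) (hmin : ∀ᶠ k in 𝓝 (0 : E), f y ≤ f (y + k)) :
    p = 0 ∧ ∀ k, 0 ≤ B k k := by
  have hp : -p = 0 := by
    refine clm_eq_zero_of_le_sq (C := ‖B‖ + 1) ?_
    filter_upwards [h 1 one_pos, hmin] with k h1 h2
    have h3 : B k k ≤ ‖B‖ * ‖k‖ * ‖k‖ := (le_abs_self _).trans (B.le_opNorm₂ k k)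
    have h4 : 0 ≤ ‖B‖ * ‖k‖ * ‖k‖ := by positivity
    simp only [_root_.neg_apply]
    nlinarith
  have hp0 : p = 0 := neg_eq_zero.1 hp
  refine ⟨hp0, fun k => ?_⟩
  have := bilin_le_of_eventually (B := -B) (c := 0) (fun η hη => ?_) k
  · simp only [_root_.neg_apply] at this
    linarith
  · filter_upwards [h (η / 2) (by positivity), hmin] with k h1 h2
    rw [hp0] at h1
    simp only [_root_.zero_apply, _root_.neg_apply] at h1 ⊢
    linarith

/-- The pair `(p, B)` is the second-order Taylor expansion of `f` at `y`. -/
def HasJet (f : E → ℝ) (y : E) (p : E →L[ℝ] ℝ) (B : E →L[ℝ] E →L[ℝ] ℝ) : Prop :=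
  ∀ η > 0, ∀ᶠ k in 𝓝 (0 : E), |f (y + k) - f y - p k - 1 / 2 * B k k| ≤ η * ‖k‖ ^ 2

theorem HasJet.jetAbove {f : E → ℝ} {y : E} {p : E →L[ℝ] ℝ} {B : E →L[ℝ] E →L[ℝ] ℝ}
    (h : HasJet f y p B) : JetAbove f y p B := by
  intro η hη
  filter_upwards [h η hη] with k hk
  linarith [(abs_le.1 hk).2]

theorem HasJet.smul {f : E → ℝ} {y : E} {p : E →L[ℝ] ℝ} {B : E →L[ℝ] E →L[ℝ] ℝ}
    (h : HasJet f y p B) (c : ℝ) : HasJet (fun z => c * f z) y (c • p) (c • B) := by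
  intro η hη
  filter_upwards [h (η / (|c| + 1)) (by positivity)] with k hk
  simp only [_root_.smul_apply, smul_eq_mul]
  rw [show c * f (y + k) - c * f y - c * p k - 1 / 2 * (c * B k k)
    = c * (f (y + k) - f y - p k - 1 / 2 * B k k) by ring, abs_mul]
  calc |c| * _ ≤ |c| * (η / (|c| + 1) * ‖k‖ ^ 2) := by gcongr
    _ ≤ (|c| + 1) * (η / (|c| + 1) * ‖k‖ ^ 2) := by gcongr; linarith
    _ = η * ‖k‖ ^ 2 := by field_simp

/-- The quadratic polynomial with value `c`, slope `p` and Hessian `B` at `a`. -/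
def quadPoly (a : E) (c : ℝ) (p : E →L[ℝ] ℝ) (B : E →L[ℝ] E →L[ℝ] ℝ) (z : E) : ℝ :=
  c + p (z - a) + 1 / 2 * B (z - a) (z - a)

theorem continuous_quadPoly (a : E) (c : ℝ) (p : E →L[ℝ] ℝ) (B : E →L[ℝ] E →L[ℝ] ℝ) :
    Continuous (quadPoly a c p B) := by
  unfold quadPoly
  fun_prop

theorem contDiff_quadPoly (a : E) (c : ℝ) (p : E →L[ℝ] ℝ) (B : E →L[ℝ] E →L[ℝ] ℝ) :
    ContDiff ℝ 2 (quadPoly a c p B) := by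
  unfold quadPoly
  fun_prop

theorem quadPoly_add {a : E} {c : ℝ} {p : E →L[ℝ] ℝ} {B : E →L[ℝ] E →L[ℝ] ℝ}
    (hB : ∀ k l, B k l = B l k) (z k : E) :
    quadPoly a c p B (z + k) = quadPoly a c p B z + (p + B (z - a)) k + 1 / 2 * B k k := by
  have := hB k (z - a)
  simp only [quadPoly, show z + k - a = (z - a) + k by abel, map_add, _root_.add_apply]
  linarith

theorem hasJet_quadPoly {a : E} {c : ℝ} {p : E →L[ℝ] ℝ} {B : E →L[ℝ] E →L[ℝ] ℝ}
    (hB : ∀ k l, B k l = B l k) (z : E) :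
    HasJet (quadPoly a c p B) z (p + B (z - a)) B := by
  intro η hη
  refine Eventually.of_forall fun k => ?_
  rw [quadPoly_add hB]
  rw [show quadPoly a c p B z + (p + B (z - a)) k + 1 / 2 * B k k - quadPoly a c p B z
    - (p + B (z - a)) k - 1 / 2 * B k k = 0 by ring, abs_zero]
  positivity

theorem hasFDerivAt_quadPoly {a : E} {c : ℝ} {p : E →L[ℝ] ℝ} {B : E →L[ℝ] E →L[ℝ] ℝ}
    (hB : ∀ k l, B k l = B l k) (z : E) :
    HasFDerivAt (quadPoly a c p B) (p + B (z - a)) z := by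
  rw [hasFDerivAt_iff_isLittleO_nhds_zero]
  have h1 : (fun k : E => quadPoly a c p B (z + k) - quadPoly a c p B z - (p + B (z - a)) k)
      =O[𝓝 0] fun k => ‖k‖ ^ 2 := by
    refine Asymptotics.IsBigO.of_bound ‖B‖ (Eventually.of_forall fun k => ?_)
    rw [quadPoly_add hB]
    have h3 : |B k k| ≤ ‖B‖ * ‖k‖ * ‖k‖ := B.le_opNorm₂ k k
    have h4 : 0 ≤ ‖B‖ * ‖k‖ * ‖k‖ := by positivity
    rw [show quadPoly a c p B z + (p + B (z - a)) k + 1 / 2 * B k k - quadPoly a c p B z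
      - (p + B (z - a)) k = 1 / 2 * B k k by ring, Real.norm_eq_abs, abs_mul, norm_pow, norm_norm,
      abs_of_pos (by norm_num : (0:ℝ) < 1 / 2)]
    nlinarith
  refine h1.trans_isLittleO ?_
  have := Asymptotics.isLittleO_norm_pow_id (E' := E) one_lt_two
  simpa using this

theorem fderiv_quadPoly {a : E} {c : ℝ} {p : E →L[ℝ] ℝ} {B : E →L[ℝ] E →L[ℝ] ℝ}
    (hB : ∀ k l, B k l = B l k) :
    fderiv ℝ (quadPoly a c p B) = fun z => p + B (z - a) :=
  funext fun z => (hasFDerivAt_quadPoly hB z).fderiv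

theorem ContDiff.hasJet {f : E → ℝ} (hf : ContDiff ℝ 2 f) (y : E) :
    (∀ k l, fderiv ℝ (fderiv ℝ f) y k l = fderiv ℝ (fderiv ℝ f) y l k) ∧
    HasJet f y (fderiv ℝ f y) (fderiv ℝ (fderiv ℝ f) y) := by
  have h1 : ContDiff ℝ 1 (fderiv ℝ f) := hf.fderiv_right (by norm_num)
  have hsymm : ∀ k l, fderiv ℝ (fderiv ℝ f) y k l = fderiv ℝ (fderiv ℝ f) y l k :=
    (hf.contDiffAt (x := y)).isSymmSndFDerivAt (by simp)
  exact ⟨hsymm, fun η hη => taylor_second_order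
    (fun z => ((hf.differentiable (by norm_num)) z).hasFDerivAt)
    ((h1.differentiable (by norm_num)) y).hasFDerivAt hsymm hη⟩

end JetCalculus

section ViscosityJets

variable {n : ℕ} {F : Mat n → ℝ} {lam Lam : ℝ}

/-- `F` as a function of symmetric bilinear forms. -/
def formOp (n : ℕ) (F : Mat n → ℝ) (B : En n →L[ℝ] En n →L[ℝ] ℝ) : ℝ := F (formMatrix n B)

theorem hess_eq_formMatrix {φ : En n → ℝ} (hφ : ContDiff ℝ 2 φ) (y : En n) :
    hess n φ y = formMatrix n (fderiv ℝ (fderiv ℝ φ) y) := by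
  have h1 : ContDiff ℝ 1 (fderiv ℝ φ) := hφ.fderiv_right (by norm_num)
  have h2 := (h1.differentiable (by norm_num)) y
  ext i j
  simp only [hess, formMatrix, Matrix.of_apply]
  rw [fderiv_clm_apply h2 (differentiableAt_const _)]
  simp

theorem hess_quadPoly {a : En n} {c : ℝ} {p : En n →L[ℝ] ℝ} {B : En n →L[ℝ] En n →L[ℝ] ℝ}
    (hB : ∀ k l, B k l = B l k) (z : En n) :
    hess n (quadPoly a c p B) z = formMatrix n B := by
  rw [hess_eq_formMatrix (contDiff_quadPoly a c p B), fderiv_quadPoly hB]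
  congr 1
  have : HasFDerivAt (fun z => p + B (z - a)) B z := by
    have h1 : HasFDerivAt (fun z => z - a) (ContinuousLinearMap.id ℝ (En n)) z :=
      (hasFDerivAt_id z).sub_const a
    simpa using (B.hasFDerivAt.comp z h1).const_add p
  exact this.fderiv

theorem symm_add_smul_innerForm {E : Type*} [NormedAddCommGroup E] [InnerProductSpace ℝ E]
    {B : E →L[ℝ] E →L[ℝ] ℝ} (hB : ∀ k l, B k l = B l k) (c : ℝ) (k l : E) :
    (B + c • innerForm E) k l = (B + c • innerForm E) l k := by
  simp only [_root_.add_apply, _root_.smul_apply, innerForm_apply, hB k l, real_inner_comm]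

theorem formOp_le_add (hF : UniformlyElliptic n lam Lam F) (hlam : 0 < lam) (h : lam ≤ Lam)
    {B : En n →L[ℝ] En n →L[ℝ] ℝ} (hB : ∀ k l, B k l = B l k) {c : ℝ} (hc : 0 ≤ c) :
    formOp n F B ≤ formOp n F (B + c • innerForm (En n)) + n * Lam * c := by
  refine hF.le_add_of_le hlam h (symm_add_smul_innerForm hB c) hB hc fun k => ?_
  simp only [_root_.add_apply, _root_.smul_apply, innerForm_apply, real_inner_self_eq_norm_sq,
    smul_eq_mul, le_refl]

theorem formOp_sub_le (hF : UniformlyElliptic n lam Lam F) (hlam : 0 < lam) (h : lam ≤ Lam)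
    {B : En n →L[ℝ] En n →L[ℝ] ℝ} (hB : ∀ k l, B k l = B l k) {c : ℝ} (hc : 0 ≤ c) :
    formOp n F (B + (-c) • innerForm (En n)) ≤ formOp n F B + n * Lam * c := by
  refine hF.le_add_of_le hlam h hB (symm_add_smul_innerForm hB (-c)) hc fun k => ?_
  simp only [_root_.add_apply, _root_.smul_apply, innerForm_apply, real_inner_self_eq_norm_sq,
    smul_eq_mul]
  linarith

theorem formOp_antitone (hF : UniformlyElliptic n lam Lam F) (hlam : 0 < lam) (h : lam ≤ Lam)
    {B₁ B₂ : En n →L[ℝ] En n →L[ℝ] ℝ} (h₁ : ∀ k l, B₁ k l = B₁ l k) (h₂ : ∀ k l, B₂ k l = B₂ l k)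
    (hB : ∀ k, B₁ k k ≤ B₂ k k) : formOp n F B₂ ≤ formOp n F B₁ := by
  have := hF.le_add_of_le hlam h h₁ h₂ le_rfl (by simpa using hB)
  simp only [mul_zero, add_zero] at this
  exact this

theorem jetSubsolution_of_quadPoly {E : Type*} [NormedAddCommGroup E] [InnerProductSpace ℝ E]
    {G : (E →L[ℝ] E →L[ℝ] ℝ) → ℝ} {v u : E → ℝ} {K : ℝ}
    (hG : ∀ B : E →L[ℝ] E →L[ℝ] ℝ, (∀ k l, B k l = B l k) → ∀ c, 0 ≤ c →
      G B ≤ G (B + c • innerForm E) + K * c)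
    (h : ∀ y p B, (∀ k l, B k l = B l k) → ∀ η > 0,
      (∀ᶠ z in 𝓝 y, u z + η * ‖z - y‖ ^ 2 ≤ quadPoly y (u y) p B z) → G B - 1 / 2 * p y ≤ v y) :
    JetSubsolution G v u := by
  intro y p B hB hJ
  have key : ∀ η > 0, G B - 1 / 2 * p y ≤ v y + K * (4 * η) := by
    intro η hη
    have h1 := hG B hB (4 * η) (by positivity)
    have h2 := h y p (B + (4 * η) • innerForm E) (symm_add_smul_innerForm hB _) η hη (by
      have h3 := hJ η hη
      have ht : Tendsto (fun z => z - y) (𝓝 y) (𝓝 0) := by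
        have : Tendsto (fun z => z - y) (𝓝 y) (𝓝 (y - y)) :=
          (continuous_id.sub continuous_const).tendsto y
        rwa [sub_self] at this
      filter_upwards [ht.eventually h3] with z hz
      rw [add_sub_cancel] at hz
      simp only [quadPoly, _root_.add_apply, _root_.smul_apply, innerForm_apply,
        real_inner_self_eq_norm_sq, smul_eq_mul]
      linarith)
    linarith
  have hlim : Tendsto (fun η : ℝ => v y + K * (4 * η)) (𝓝[>] 0) (𝓝 (v y + K * (4 * 0))) :=
    ((by fun_prop : Continuous fun η : ℝ => v y + K * (4 * η)).tendsto 0).mono_left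
      nhdsWithin_le_nhds
  have := ge_of_tendsto hlim (eventually_mem_nhdsWithin.mono fun η hη => key η hη)
  simpa using this

theorem viscSubE_iff_jetSubsolution (hF : UniformlyElliptic n lam Lam F) (hlam : 0 < lam)
    (h : lam ≤ Lam) {v u : En n → ℝ} :
    ViscSubE n univ (Fop n F 0 v) u ↔ JetSubsolution (formOp n F) v u := by
  constructor
  · intro hu
    refine jetSubsolution_of_quadPoly (K := n * Lam)
      (fun B hB c hc => formOp_le_add hF hlam h hB hc) fun y p B hB η hη hle => ?_
    have h1 := hu y (mem_univ y) (quadPoly y (u y) p B) (contDiff_quadPoly _ _ _ _) (by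
      rw [isLocalMaxOn_univ_iff]
      filter_upwards [hle] with z hz
      have hz' : 0 ≤ η * ‖z - y‖ ^ 2 := by positivity
      simp only [quadPoly, sub_self, map_zero, mul_zero] at hz ⊢
      linarith)
    simp only [Fop, hess_quadPoly hB, fderiv_quadPoly hB, sub_self, map_zero, add_zero,
      zero_mul] at h1
    simp only [formOp]
    linarith
  · intro hu y _ φ hφ hmax
    obtain ⟨hs, hj⟩ := hφ.hasJet y
    rw [isLocalMaxOn_univ_iff] at hmax
    have h1 := hu y (fderiv ℝ φ y) _ hs (fun η hη => by
      filter_upwards [hj.jetAbove η hη, (continuous_const_add y).tendsto' 0 y (add_zero y)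
        |>.eventually hmax] with k h1 h2
      linarith)
    simp only [Fop, hess_eq_formMatrix hφ, zero_mul]
    simp only [formOp] at h1
    linarith

theorem viscSupE_iff_jetSubsolution (hF : UniformlyElliptic n lam Lam F) (hlam : 0 < lam)
    (h : lam ≤ Lam) {v u : En n → ℝ} :
    ViscSupE n univ (Fop n F 0 v) u ↔
      JetSubsolution (fun B => -formOp n F (-B)) (fun y => -v y) (fun y => -u y) := by
  constructor
  · intro hu
    refine jetSubsolution_of_quadPoly (K := n * Lam) (fun B hB c hc => ?_) fun y p B hB η hη hle => ?_
    · have := formOp_sub_le hF hlam h (B := -B) (by simpa using hB) hc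
      have e : -B + (-c) • innerForm (En n) = -(B + c • innerForm (En n)) := by
        ext k l
        simp only [_root_.add_apply, _root_.neg_apply, _root_.smul_apply, smul_eq_mul]
        ring
      rw [e] at this
      linarith
    have hB' : ∀ k l, (-B) k l = (-B) l k := by simpa using hB
    have h1 := hu y (mem_univ y) (quadPoly y (u y) (-p) (-B)) (contDiff_quadPoly _ _ _ _) (by
      rw [isLocalMinOn_univ_iff]
      filter_upwards [hle] with z hz
      have hz' : 0 ≤ η * ‖z - y‖ ^ 2 := by positivity
      simp only [quadPoly, sub_self, map_zero, mul_zero, _root_.neg_apply] at hz ⊢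
      linarith)
    simp only [Fop, hess_quadPoly hB', fderiv_quadPoly hB', sub_self, map_zero, add_zero,
      zero_mul, _root_.neg_apply] at h1
    simp only [formOp]
    linarith
  · intro hu y _ φ hφ hmin
    obtain ⟨hs, hj⟩ := hφ.hasJet y
    rw [isLocalMinOn_univ_iff] at hmin
    have h1 := hu y (-fderiv ℝ φ y) (-fderiv ℝ (fderiv ℝ φ) y) (by simpa using hs) (fun η hη => by
      filter_upwards [hj η hη, (continuous_const_add y).tendsto' 0 y (add_zero y)
        |>.eventually hmin] with k h1 h2
      have := (abs_le.1 h1).1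
      simp only [_root_.neg_apply]
      linarith)
    simp only [Fop, hess_eq_formMatrix hφ, zero_mul]
    have e : -(-fderiv ℝ (fderiv ℝ φ) y) = fderiv ℝ (fderiv ℝ φ) y := by
      ext k l
      simp only [neg_neg]
    dsimp only at h1
    rw [e] at h1
    simp only [formOp, _root_.neg_apply] at h1
    linarith

end ViscosityJets

section Gaussian

variable {E : Type*} [NormedAddCommGroup E]

/-- The Gaussian `y ↦ exp (-b |y|²)`. -/
def gauss (b : ℝ) (y : E) : ℝ := Real.exp (-b * ‖y‖ ^ 2)

theorem gauss_pos (b : ℝ) (y : E) : 0 < gauss b y := Real.exp_pos _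

theorem continuous_gauss (b : ℝ) : Continuous (gauss b : E → ℝ) := by
  unfold gauss; fun_prop

theorem gauss_le_one {b : ℝ} (hb : 0 ≤ b) (y : E) : gauss b y ≤ 1 := by
  refine Real.exp_le_one_iff.2 ?_
  rw [neg_mul]
  exact neg_nonpos.2 (by positivity)

theorem one_add_sq_mul_gauss_le {b : ℝ} (hb : 0 < b) (y : E) :
    (1 + ‖y‖ ^ 2) * gauss b y ≤ 1 + 1 / b := by
  have h1 := gauss_le_one hb.le y
  have h2 : b * ‖y‖ ^ 2 * gauss b y ≤ 1 := by
    have h3 := Real.add_one_le_exp (b * ‖y‖ ^ 2)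
    have h4 : gauss b y = (Real.exp (b * ‖y‖ ^ 2))⁻¹ := by
      rw [gauss, neg_mul, Real.exp_neg]
    rw [h4, ← div_eq_mul_inv, div_le_one (Real.exp_pos _)]
    linarith
  have h5 : ‖y‖ ^ 2 * gauss b y ≤ 1 / b := by
    rw [le_div_iff₀ hb]; linarith
  linarith

theorem tendsto_one_add_sq_mul_gauss [ProperSpace E] {b : ℝ} (hb : 0 < b) :
    Tendsto (fun y : E => (1 + ‖y‖ ^ 2) * gauss b y) (cocompact E) (𝓝 0) := by
  have h0 : Tendsto (fun y : E => b * ‖y‖ ^ 2) (cocompact E) atTop :=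
    ((tendsto_pow_atTop two_ne_zero).comp (tendsto_norm_cocompact_atTop (E := E))).const_mul_atTop hb
  have h1 := (Real.tendsto_pow_mul_exp_neg_atTop_nhds_zero 0).comp h0
  have h2 := ((Real.tendsto_pow_mul_exp_neg_atTop_nhds_zero 1).comp h0).const_mul (1 / b)
  have h3 := h1.add h2
  simp only [mul_zero, add_zero] at h3
  refine h3.congr fun y => ?_
  simp only [Function.comp_apply, gauss, neg_mul]
  field_simp

variable [InnerProductSpace ℝ E]

/-- The differential of the Gaussian. -/
def gaussGrad (b : ℝ) (y : E) : E →L[ℝ] ℝ := (-2 * b * gauss b y) • innerForm E y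

/-- The Hessian of the Gaussian. -/
def gaussHess (b : ℝ) (y : E) : E →L[ℝ] E →L[ℝ] ℝ :=
  (-2 * b * gauss b y) • innerForm E + ((-2 * b) • gaussGrad b y).smulRight (innerForm E y)

theorem gaussHess_apply (b : ℝ) (y k l : E) : gaussHess b y k l
    = gauss b y * (4 * b ^ 2 * (inner ℝ y k * inner ℝ y l) - 2 * b * inner ℝ k l) := by
  simp only [gaussHess, gaussGrad, _root_.add_apply, _root_.smul_apply, innerForm_apply,
    ContinuousLinearMap.smulRight_apply, smul_eq_mul]
  ring

theorem gaussHess_symm (b : ℝ) (y k l : E) : gaussHess b y k l = gaussHess b y l k := by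
  rw [gaussHess_apply, gaussHess_apply, real_inner_comm l k]
  ring

theorem hasFDerivAt_gauss (b : ℝ) (y : E) : HasFDerivAt (gauss b) (gaussGrad b y) y := by
  have h1 : HasFDerivAt (fun z : E => ‖z‖ ^ 2) (2 • innerSL ℝ y) y :=
    (hasStrictFDerivAt_norm_sq y).hasFDerivAt
  have h2 := (h1.const_mul (-b)).exp
  have e : gaussGrad b y = Real.exp (-b * ‖y‖ ^ 2) • (-b) • 2 • innerSL ℝ y := by
    ext k
    simp only [gaussGrad, gauss, _root_.smul_apply, innerForm_apply, smul_eq_mul,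
      innerSL_apply_apply, nsmul_eq_mul, Nat.cast_ofNat]
    ring
  rw [e]
  exact h2

theorem hasJet_gauss (b : ℝ) (y : E) : HasJet (gauss b) y (gaussGrad b y) (gaussHess b y) := by
  intro η hη
  refine taylor_second_order (hasFDerivAt_gauss b) ?_ (gaussHess_symm b y) hη
  have h1 : HasFDerivAt (fun z : E => -2 * b * gauss b z) ((-2 * b) • gaussGrad b y) y :=
    (hasFDerivAt_gauss b y).const_mul _
  exact h1.smul (innerForm E).hasFDerivAt

end Gaussian

section GaussianBarrier

variable {n : ℕ} {F : Mat n → ℝ} {lam Lam : ℝ}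

theorem formOp_add_gauss_ge (hF : UniformlyElliptic n lam Lam F) (hlam : 0 < lam) (h : lam ≤ Lam)
    (hn : 1 ≤ n) : ∃ c : ℝ, 0 < c ∧ ∀ κ : ℝ, 0 ≤ κ → ∀ (y : En n) (B : En n →L[ℝ] En n →L[ℝ] ℝ),
      (∀ k l, B k l = B l k) → formOp n F B + κ * (c * ((1 + ‖y‖ ^ 2) * gauss (1 / (8 * Lam)) y))
        ≤ formOp n F (B + κ • gaussHess (1 / (8 * Lam)) y)
          - 1 / 2 * (κ • gaussGrad (1 / (8 * Lam)) y) y := by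
  have hLam : 0 < Lam := hlam.trans_le h
  set b := 1 / (8 * Lam) with hbdef
  have hb : 0 < b := by positivity
  have hbL : b * Lam = 1 / 8 := by rw [hbdef]; field_simp
  have hn' : (1 : ℝ) ≤ n := by exact_mod_cast hn
  refine ⟨min (b / 2) (2 * b * lam), by positivity, fun κ hκ y B hB => ?_⟩
  set w := gauss b y with hw
  have hw0 : 0 < w := gauss_pos b y
  have hB' : ∀ k l, (B + κ • gaussHess b y) k l = (B + κ • gaussHess b y) l k := fun k l => by
    simp only [_root_.add_apply, _root_.smul_apply, hB k l, gaussHess_symm b y k l]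
  have h1 := hF.sub_le_of_le_inner h hB hB' (α := κ * w * (4 * b ^ 2)) (β := κ * w * (2 * b))
    hlam (by positivity) (by positivity) y (fun k => by
      simp only [_root_.add_apply, _root_.smul_apply, gaussHess_apply, smul_eq_mul,
        real_inner_self_eq_norm_sq, ← hw]
      apply le_of_eq
      ring)
  have h2 : (κ • gaussGrad b y) y = -(κ * w * (2 * b) * ‖y‖ ^ 2) := by
    simp only [gaussGrad, _root_.smul_apply, innerForm_apply, smul_eq_mul,
      real_inner_self_eq_norm_sq, ← hw]
    ring
  rw [h2]
  unfold formOp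
  have h3 : κ * w * (4 * b ^ 2) * Lam * ‖y‖ ^ 2 = κ * w * (b / 2 * ‖y‖ ^ 2) := by
    rw [show κ * w * (4 * b ^ 2) * Lam * ‖y‖ ^ 2 = κ * w * (4 * b * ‖y‖ ^ 2) * (b * Lam) by ring, hbL]
    ring
  rw [h3] at h1
  have h4 : κ * w * (min (b / 2) (2 * b * lam) * (1 + ‖y‖ ^ 2))
      ≤ κ * w * (b / 2 * ‖y‖ ^ 2 + 2 * b * lam * n) := by
    refine mul_le_mul_of_nonneg_left ?_ (by positivity)
    have e1 : min (b / 2) (2 * b * lam) * ‖y‖ ^ 2 ≤ b / 2 * ‖y‖ ^ 2 := by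
      gcongr; exact min_le_left _ _
    have e2 : min (b / 2) (2 * b * lam) ≤ 2 * b * lam * n :=
      (min_le_right _ _).trans (le_mul_of_one_le_right (by positivity) hn')
    linarith
  linarith

theorem JetSubsolution.sub_gauss {c : ℝ}
    (hc : ∀ κ : ℝ, 0 ≤ κ → ∀ (y : En n) (B : En n →L[ℝ] En n →L[ℝ] ℝ),
      (∀ k l, B k l = B l k) → formOp n F B + κ * (c * ((1 + ‖y‖ ^ 2) * gauss (1 / (8 * Lam)) y))
        ≤ formOp n F (B + κ • gaussHess (1 / (8 * Lam)) y)
          - 1 / 2 * (κ • gaussGrad (1 / (8 * Lam)) y) y)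
    {v u : En n → ℝ} (hu : JetSubsolution (formOp n F) v u) {κ : ℝ} (hκ : 0 ≤ κ) :
    JetSubsolution (formOp n F)
      (fun y => v y - κ * (c * ((1 + ‖y‖ ^ 2) * gauss (1 / (8 * Lam)) y)))
      (fun y => u y - κ * gauss (1 / (8 * Lam)) y) := by
  intro y p B hB hJ
  have h1 := hJ.add ((hasJet_gauss (1 / (8 * Lam)) y).smul κ).jetAbove
  simp only [sub_add_cancel] at h1
  have h2 := hu y _ _ (fun k l => by
    simp only [_root_.add_apply, _root_.smul_apply, hB k l, gaussHess_symm _ y k l]) h1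
  have h3 := hc κ hκ y B hB
  rw [_root_.add_apply] at h2
  linarith

/-- Comparison for semicontinuous sub- and supersolutions decaying at infinity. -/
theorem le_of_jetSubsolution (hF : UniformlyElliptic n lam Lam F) (hlam : 0 < lam) (h : lam ≤ Lam)
    (hn : 1 ≤ n) {v u₁ u₂ : En n → ℝ} {M : ℝ} (hv : Continuous v)
    (hs₁ : JetSubsolution (formOp n F) v u₁)
    (hs₂ : JetSubsolution (fun B => -formOp n F (-B)) (fun y => -v y) (fun y => -u₂ y))
    (hu₁ : UpperSemicontinuous u₁) (hu₂ : UpperSemicontinuous fun y => -u₂ y)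
    (hM₁ : ∀ x, |u₁ x| ≤ M) (hM₂ : ∀ x, |u₂ x| ≤ M)
    (hi₁ : ∀ η > 0, ∀ᶠ x in cocompact (En n), u₁ x ≤ η)
    (hi₂ : ∀ η > 0, ∀ᶠ x in cocompact (En n), -u₂ x ≤ η) (x : En n) : u₁ x ≤ u₂ x := by
  have hLam : 0 < Lam := hlam.trans_le h
  obtain ⟨c, hc, hcF⟩ := formOp_add_gauss_ge hF hlam h hn
  have hb : (0 : ℝ) ≤ 1 / (8 * Lam) := by positivity
  refine le_of_forall_pos_le_add fun κ hκ => ?_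
  have hcg := continuous_gauss (E := En n) (1 / (8 * Lam))
  have key := JetSubsolution.add_nonpos (C := n * Lam) (M := M + κ) (by positivity)
    (hs₁.sub_gauss hcF hκ.le) hs₂ ?_ hu₂ (fun x => ?_) (fun x => ?_) ?_ (fun η hη => ?_) hi₂
    (by fun_prop) hv.neg (fun x => ?_) x
  · have h1 : κ * gauss (1 / (8 * Lam)) x ≤ κ * 1 :=
      mul_le_mul_of_nonneg_left (gauss_le_one hb x) hκ.le
    linarith
  · have : Continuous fun y : En n => -(κ * gauss (1 / (8 * Lam)) y) := by fun_prop
    simpa only [sub_eq_add_neg] using hu₁.add this.upperSemicontinuous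
  · have h1 : κ * gauss (1 / (8 * Lam)) x ≤ κ * 1 :=
      mul_le_mul_of_nonneg_left (gauss_le_one hb x) hκ.le
    have h2 : 0 < κ * gauss (1 / (8 * Lam)) x := mul_pos hκ (gauss_pos _ x)
    have h3 := abs_le.1 (hM₁ x)
    rw [abs_le]
    constructor <;> linarith [h3.1, h3.2]
  · rw [abs_neg]
    linarith [hM₂ x]
  · intro B₁ B₂ h₁ h₂ d hd hle
    have := hF.le_add_of_le hlam h (B₂ := -B₂) h₁ (by simpa using h₂) hd (fun k => by
      have := hle k
      simp only [_root_.neg_apply]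
      linarith)
    unfold formOp
    linarith
  · filter_upwards [hi₁ η hη] with x hx
    have h2 : 0 < κ * gauss (1 / (8 * Lam)) x := mul_pos hκ (gauss_pos _ x)
    linarith
  · have : 0 < κ * (c * ((1 + ‖x‖ ^ 2) * gauss (1 / (8 * Lam)) x)) := by
      have := gauss_pos (1 / (8 * Lam)) x
      positivity
    linarith

end GaussianBarrier

section Perron

theorem exists_uscEnvelope {X : Type*} [TopologicalSpace X] {U : X → ℝ} {M : ℝ}
    (hM : ∀ x, |U x| ≤ M) : ∃ V : X → ℝ, UpperSemicontinuous V ∧ (∀ x, U x ≤ V x) ∧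
      ∀ x, ∀ t < V x, ∃ᶠ z in 𝓝 x, t < U z := by
  have hbelow : ∀ x, BddBelow {t | ∀ᶠ z in 𝓝 x, U z ≤ t} := fun x =>
    ⟨U x, fun t ht => (show ∀ᶠ z in 𝓝 x, U z ≤ t from ht).self_of_nhds⟩
  have hne : ∀ x, {t | ∀ᶠ z in 𝓝 x, U z ≤ t}.Nonempty := fun x =>
    ⟨M, Eventually.of_forall fun z => (abs_le.1 (hM z)).2⟩
  refine ⟨fun x => sInf {t | ∀ᶠ z in 𝓝 x, U z ≤ t}, fun x t ht => ?_, fun x => ?_, fun x t ht => ?_⟩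
  · obtain ⟨s, hs, hst⟩ := exists_lt_of_csInf_lt (hne x) ht
    have hs' : ∀ᶠ z in 𝓝 x, U z ≤ s := hs
    filter_upwards [hs'.eventually_nhds] with z hz
    exact (csInf_le (hbelow z) hz).trans_lt hst
  · exact le_csInf (hne x) fun t ht => (show ∀ᶠ z in 𝓝 x, U z ≤ t from ht).self_of_nhds
  · intro hcon
    refine (csInf_le (hbelow x) (?_ : ∀ᶠ z in 𝓝 x, U z ≤ t)).not_gt ht
    exact hcon.mono fun z hz => not_lt.1 hz

variable {E : Type*} [NormedAddCommGroup E] [InnerProductSpace ℝ E]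
  {G : (E →L[ℝ] E →L[ℝ] ℝ) → ℝ} {v : E → ℝ} {K : ℝ}

/-- The upper envelope of a family of subsolutions is a subsolution. -/
theorem JetSubsolution.of_family [FiniteDimensional ℝ E]
    (hG : ∀ B : E →L[ℝ] E →L[ℝ] ℝ, (∀ k l, B k l = B l k) → ∀ c, 0 ≤ c →
      G B ≤ G (B + c • innerForm E) + K * c) (hv : Continuous v)
    {S : Set (E → ℝ)} (hS : ∀ s ∈ S, UpperSemicontinuous s ∧ JetSubsolution G v s)
    {U : E → ℝ} (hle : ∀ s ∈ S, ∀ z, s z ≤ U z)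
    (happ : ∀ y, ∀ t < U y, ∃ᶠ z in 𝓝 y, ∃ s ∈ S, t < s z) : JetSubsolution G v U := by
  refine jetSubsolution_of_quadPoly hG fun y p B hB η hη hq => ?_
  set Q := quadPoly y (U y) p B with hQ
  have hQc : Continuous Q := continuous_quadPoly _ _ _ _
  have hQy : Q y = U y := by simp [hQ, quadPoly]
  obtain ⟨r, hr, hball⟩ := Metric.eventually_nhds_iff_ball.1 hq
  have key : ∃ᶠ z in 𝓝 y, G B - 1 / 2 * (p + B (z - y)) z - v z ≤ 0 := by
    rw [Metric.nhds_basis_ball.frequently_iff]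
    intro ρ' hρ'
    set ρ := min (ρ' / 2) (r / 2) with hρdef
    have hρ : 0 < ρ := by positivity
    have hρρ' : ρ < ρ' := (min_le_left _ _).trans_lt (by linarith)
    have hρr : ρ < r := (min_le_right _ _).trans_lt (by linarith)
    have hnear : ∀ᶠ z in 𝓝 y, z ∈ Metric.ball y ρ ∧ Q z < U y + η * ρ ^ 2 / 4 := by
      have hmem : ∀ᶠ z in 𝓝 y, z ∈ Metric.ball y ρ := Metric.ball_mem_nhds y hρ
      refine hmem.and (hQc.continuousAt.eventually_lt continuousAt_const ?_)
      rw [hQy]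
      have : 0 < η * ρ ^ 2 / 4 := by positivity
      linarith
    have hlt : U y - η * ρ ^ 2 / 4 < U y := by
      have : 0 < η * ρ ^ 2 / 4 := by positivity
      linarith
    obtain ⟨z₀, ⟨s, hsS, hs⟩, hz₀, hQz₀⟩ := ((happ y _ hlt).and_eventually hnear).exists
    obtain ⟨husc, hsub⟩ := hS s hsS
    have husc' : UpperSemicontinuous fun z => s z - Q z := by
      have hQn : UpperSemicontinuous fun z => -Q z := hQc.neg.upperSemicontinuous
      simpa only [sub_eq_add_neg] using husc.add hQn
    obtain ⟨z, hz, hzmax⟩ := UpperSemicontinuousOn.exists_isMaxOn (s := Metric.closedBall y ρ)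
      ⟨z₀, Metric.ball_subset_closedBall hz₀⟩ (isCompact_closedBall y ρ)
      (husc'.upperSemicontinuousOn _)
    have h1 : s z₀ - Q z₀ ≤ s z - Q z := hzmax (Metric.ball_subset_closedBall hz₀)
    have h2 := hball z (Metric.closedBall_subset_ball hρr hz)
    have h3 := hle s hsS z
    have h4 : ‖z - y‖ < ρ := by
      have h5 : η * ‖z - y‖ ^ 2 < η * ρ ^ 2 := by
        have : 0 < η * ρ ^ 2 := by positivity
        linarith
      exact lt_of_pow_lt_pow_left₀ 2 hρ.le (lt_of_mul_lt_mul_left h5 hη.le)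
    have hzball : z ∈ Metric.ball y ρ := mem_ball_iff_norm.2 h4
    refine ⟨z, Metric.ball_subset_ball hρρ'.le hzball, ?_⟩
    have h6 := hsub z (p + B (z - y)) B hB (fun θ hθ => by
      filter_upwards [(continuous_const_add z).tendsto' 0 z (add_zero z)
        |>.eventually (Metric.isOpen_ball.mem_nhds hzball)] with k hk
      have h7 : s (z + k) - Q (z + k) ≤ s z - Q z := hzmax (Metric.ball_subset_closedBall hk)
      rw [hQ, quadPoly_add hB] at h7
      have : 0 ≤ θ * ‖k‖ ^ 2 := by positivity
      linarith)
    linarith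
  have hcont : Continuous fun z => G B - 1 / 2 * (p + B (z - y)) z - v z := by
    simp only [_root_.add_apply]
    fun_prop
  by_contra! hcon
  have h1 : ∀ᶠ z in 𝓝 y, 0 < G B - 1 / 2 * (p + B (z - y)) z - v z := by
    refine hcont.continuousAt.eventually_const_lt ?_
    simp only [sub_self, map_zero, add_zero]
    linarith
  obtain ⟨z, hz1, hz2⟩ := (key.and_eventually h1).exists
  linarith

/-- The lower envelope of a maximal subsolution below a supersolution `Ψ` is a supersolution. -/
theorem jetSupersolution_of_maximal
    (hG : ∀ B : E →L[ℝ] E →L[ℝ] ℝ, (∀ k l, B k l = B l k) → ∀ c, 0 ≤ c →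
      G (B + (-c) • innerForm E) ≤ G B + K * c)
    (hGm : ∀ B₁ B₂ : E →L[ℝ] E →L[ℝ] ℝ, (∀ k l, B₁ k l = B₁ l k) → (∀ k l, B₂ k l = B₂ l k) →
      (∀ k, B₁ k k ≤ B₂ k k) → G B₂ ≤ G B₁) (hK : 0 ≤ K) (hv : Continuous v)
    {U V Ψ : E → ℝ} (hUu : UpperSemicontinuous U) (hU : JetSubsolution G v U)
    (hVU : ∀ z, V z ≤ U z) (hfreq : ∀ y, ∀ t, V y < t → ∃ᶠ z in 𝓝 y, U z < t)
    (hUΨ : ∀ z, U z ≤ Ψ z) (hΨc : Continuous Ψ)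
    (hΨ : JetSubsolution (fun B => -G (-B)) (fun y => -v y) (fun y => -Ψ y))
    (hmax : ∀ W : E → ℝ, UpperSemicontinuous W → JetSubsolution G v W → (∀ z, U z ≤ W z) →
      (∀ z, W z ≤ Ψ z) → ∀ z, W z ≤ U z) :
    JetSubsolution (fun B => -G (-B)) (fun y => -v y) (fun y => -V y) := by
  intro y p B hB hJ
  rcases ((hVU y).trans (hUΨ y)).eq_or_lt with heq | hlt
  · exact hΨ y p B hB (hJ.mono (by rw [heq]) (Eventually.of_forall fun k =>
      neg_le_neg ((hVU _).trans (hUΨ _))))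
  by_contra! hcon
  have hB0 : ∀ k l, (-B) k l = (-B) l k := by simpa using hB
  set gap := v y - (G (-B) + 1 / 2 * p y) with hgap
  have hgap0 : 0 < gap := by linarith
  obtain ⟨η, hη, hηgap⟩ : ∃ η > 0, K * (4 * η) < gap := by
    refine ⟨gap / (8 * (K + 1)), by positivity, ?_⟩
    rw [show K * (4 * (gap / (8 * (K + 1)))) = gap * (K / (K + 1)) / 2 by field_simp; ring]
    have : K / (K + 1) ≤ 1 := (div_le_one (by positivity)).2 (by linarith)
    nlinarith
  have hGB := hG (-B) hB0 (4 * η) (by positivity)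
  set B₁ := -B + (-(4 * η)) • innerForm E with hB₁
  have hS₁ : ∀ k l, B₁ k l = B₁ l k := symm_add_smul_innerForm hB0 _
  set Q := quadPoly y (V y) (-p) B₁ with hQ
  have hQc : Continuous Q := continuous_quadPoly _ _ _ _
  have hQy : Q y = V y := by simp [hQ, quadPoly]
  set d := (Ψ y - V y) / 2 with hd
  have hd0 : 0 < d := by linarith
  have hcont : Continuous fun z => v z - G B₁ - 1 / 2 * (p - B₁ (z - y)) z := by
    simp only [_root_.sub_apply]
    fun_prop
  have hn1 : ∀ᶠ z in 𝓝 y, 0 < v z - G B₁ - 1 / 2 * (p - B₁ (z - y)) z := by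
    refine hcont.continuousAt.eventually_const_lt ?_
    simp only [sub_self, map_zero, sub_zero]
    linarith
  have hn2 : ∀ᶠ z in 𝓝 y, Q z + d < Ψ z := by
    refine (hQc.add continuous_const).continuousAt.eventually_lt hΨc.continuousAt ?_
    show Q y + d < Ψ y
    rw [hQy]
    linarith
  have hn3 : ∀ᶠ z in 𝓝 y, Q z + η * ‖z - y‖ ^ 2 ≤ V z := by
    have ht : Tendsto (fun z => z - y) (𝓝 y) (𝓝 0) := by
      have : Tendsto (fun z => z - y) (𝓝 y) (𝓝 (y - y)) :=
        (continuous_id.sub continuous_const).tendsto y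
      rwa [sub_self] at this
    filter_upwards [ht.eventually (hJ η hη)] with z hz
    rw [add_sub_cancel] at hz
    simp only [hQ, quadPoly, hB₁, _root_.add_apply, _root_.smul_apply, _root_.neg_apply,
      innerForm_apply, real_inner_self_eq_norm_sq, smul_eq_mul]
    linarith
  obtain ⟨r, hr, hball⟩ := Metric.eventually_nhds_iff_ball.1 (hn1.and (hn2.and hn3))
  set δ := min d (η * r ^ 2 / 8) with hδ
  have hδ0 : 0 < δ := by positivity
  have hfar : ∀ z, z ∈ Metric.ball y r → r / 2 < ‖z - y‖ → Q z + δ ≤ U z := by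
    intro z hz hzr
    have h1 := (hball z hz).2.2
    have h2 : η * (r / 2) ^ 2 ≤ η * ‖z - y‖ ^ 2 := by gcongr
    have h3 : δ ≤ η * r ^ 2 / 8 := min_le_right _ _
    have h4 : 0 < η * r ^ 2 := by positivity
    linarith [hVU z]
  classical
  set W : E → ℝ := fun z => if z ∈ Metric.ball y r then max (U z) (Q z + δ) else U z with hW
  have hWin : ∀ z, z ∈ Metric.ball y r → W z = max (U z) (Q z + δ) := fun z hz => if_pos hz
  have hWout : ∀ z, r / 2 < ‖z - y‖ → W z = U z := by
    intro z hz
    by_cases hzb : z ∈ Metric.ball y r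
    · rw [hWin z hzb, max_eq_left (hfar z hzb hz)]
    · exact if_neg hzb
  have hUW : ∀ z, U z ≤ W z := by
    intro z
    by_cases hzb : z ∈ Metric.ball y r
    · rw [hWin z hzb]; exact le_max_left _ _
    · exact (if_neg hzb : W z = U z).ge
  have hnotin : ∀ z, z ∉ Metric.ball y r → r / 2 < ‖z - y‖ := by
    intro z hz
    rw [mem_ball_iff_norm, not_lt] at hz
    linarith
  have hWΨ : ∀ z, W z ≤ Ψ z := by
    intro z
    by_cases hzb : z ∈ Metric.ball y r
    · rw [hWin z hzb]
      have := (hball z hzb).2.1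
      exact max_le (hUΨ z) (by linarith [min_le_left d (η * r ^ 2 / 8)])
    · rw [hWout z (hnotin z hzb)]; exact hUΨ z
  have hWu : UpperSemicontinuous W := by
    intro z t ht
    by_cases hzb : z ∈ Metric.ball y r
    · rw [hWin z hzb] at ht
      have h1 := hUu z t ((le_max_left _ _).trans_lt ht)
      have h2 : ∀ᶠ x in 𝓝 z, Q x + δ < t :=
        (hQc.add continuous_const).continuousAt.eventually_lt_const ((le_max_right _ _).trans_lt ht)
      filter_upwards [h1, h2, Metric.isOpen_ball.mem_nhds hzb] with x hx1 hx2 hx3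
      rw [hWin x hx3]
      exact max_lt hx1 hx2
    · have hz := hnotin z hzb
      rw [hWout z hz] at ht
      have h2 : ∀ᶠ x in 𝓝 z, r / 2 < ‖x - y‖ :=
        (by fun_prop : Continuous fun x : E => ‖x - y‖).continuousAt.eventually_const_lt hz
      filter_upwards [hUu z t ht, h2] with x hx1 hx2
      rwa [hWout x hx2]
  have hWs : JetSubsolution G v W := by
    intro z p' B' hB' hJ'
    by_cases hz : W z = U z
    · exact hU z p' B' hB' (hJ'.mono hz.symm (Eventually.of_forall fun k => hUW _))
    have hzb : z ∈ Metric.ball y r := by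
      by_contra hzb
      exact hz (hWout z (hnotin z hzb))
    have hWz : W z = Q z + δ := by
      rw [hWin z hzb] at hz ⊢
      rcases max_choice (U z) (Q z + δ) with h1 | h1
      · exact absurd h1 hz
      · exact h1
    have hJQ : JetAbove (fun x => Q x + δ) z p' B' := hJ'.mono hWz.symm (by
      filter_upwards [(continuous_const_add z).tendsto' 0 z (add_zero z)
        |>.eventually (Metric.isOpen_ball.mem_nhds hzb)] with k hk
      rw [hWin _ hk]
      exact le_max_right _ _)
    have hJn := ((hasJet_quadPoly (a := y) (c := V y) (p := -p) hS₁ z).smul (-1)).jetAbove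
    obtain ⟨hp', hBB⟩ := (hJQ.add hJn).of_isLocalMin (Eventually.of_forall fun k => by
      simp only [← hQ]
      linarith)
    have h1 := hGm B₁ B' hS₁ hB' (fun k => by
      have := hBB k
      simp only [_root_.add_apply, _root_.smul_apply, smul_eq_mul] at this
      linarith)
    have h2 := congrArg (fun ℓ : E →L[ℝ] ℝ => ℓ z) hp'
    simp only [_root_.add_apply, _root_.smul_apply, smul_eq_mul, _root_.neg_apply,
      _root_.zero_apply] at h2
    have h3 := (hball z hzb).1
    rw [_root_.sub_apply] at h3
    linarith
  have hWU := hmax W hWu hWs hUW hWΨ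
  have hev : ∀ᶠ z in 𝓝 y, V y + δ / 2 < Q z + δ := by
    refine (hQc.add continuous_const).continuousAt.eventually_const_lt ?_
    show V y + δ / 2 < Q y + δ
    rw [hQy]
    linarith
  obtain ⟨z, hz1, hz2, hz3⟩ := ((hfreq y (V y + δ / 2) (by linarith)).and_eventually
    (hev.and (Metric.ball_mem_nhds y hr))).exists
  have h1 := hWU z
  rw [hWin z hz3] at h1
  linarith [le_max_right (U z) (Q z + δ)]

end Perron

section Existence

/-- The Perron method between the subsolution `0` and a continuous bounded supersolution `Ψ`. -/
theorem exists_perron {E : Type*} [NormedAddCommGroup E] [InnerProductSpace ℝ E]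
    [FiniteDimensional ℝ E] {G : (E →L[ℝ] E →L[ℝ] ℝ) → ℝ} {v : E → ℝ} {K : ℝ}
    (hG : ∀ B : E →L[ℝ] E →L[ℝ] ℝ, (∀ k l, B k l = B l k) → ∀ c, 0 ≤ c →
      G B ≤ G (B + c • innerForm E) + K * c)
    (hG' : ∀ B : E →L[ℝ] E →L[ℝ] ℝ, (∀ k l, B k l = B l k) → ∀ c, 0 ≤ c →
      G (B + (-c) • innerForm E) ≤ G B + K * c)
    (hGm : ∀ B₁ B₂ : E →L[ℝ] E →L[ℝ] ℝ, (∀ k l, B₁ k l = B₁ l k) → (∀ k l, B₂ k l = B₂ l k) →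
      (∀ k, B₁ k k ≤ B₂ k k) → G B₂ ≤ G B₁) (hK : 0 ≤ K) (hv : Continuous v)
    {Ψ : E → ℝ} {M : ℝ} (hΨc : Continuous Ψ) (hΨ0 : ∀ z, 0 ≤ Ψ z) (hΨM : ∀ z, Ψ z ≤ M)
    (hΨ : JetSubsolution (fun B => -G (-B)) (fun y => -v y) (fun y => -Ψ y))
    (h0 : JetSubsolution G v fun _ => 0) :
    ∃ U V : E → ℝ, UpperSemicontinuous U ∧ (UpperSemicontinuous fun y => -V y) ∧
      JetSubsolution G v U ∧
      JetSubsolution (fun B => -G (-B)) (fun y => -v y) (fun y => -V y) ∧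
      (∀ z, 0 ≤ V z) ∧ (∀ z, V z ≤ U z) ∧ ∀ z, U z ≤ Ψ z := by
  let S : Set (E → ℝ) := {s | (UpperSemicontinuous s ∧ JetSubsolution G v s) ∧ ∀ z, s z ≤ Ψ z}
  have h0S : (fun _ => 0 : E → ℝ) ∈ S := ⟨⟨upperSemicontinuous_const, h0⟩, hΨ0⟩
  let U₀ : E → ℝ := fun z => ⨆ s : S, s.1 z
  have : Nonempty S := ⟨⟨_, h0S⟩⟩
  have hbdd : ∀ z, BddAbove (range fun s : S => s.1 z) := fun z =>
    ⟨Ψ z, by rintro _ ⟨s, rfl⟩; exact s.2.2 z⟩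
  have hSU₀ : ∀ s ∈ S, ∀ z, s z ≤ U₀ z := fun s hs z => le_ciSup (hbdd z) ⟨s, hs⟩
  have hU₀Ψ : ∀ z, U₀ z ≤ Ψ z := fun z => ciSup_le fun s => s.2.2 z
  have hU₀0 : ∀ z, 0 ≤ U₀ z := hSU₀ _ h0S
  have hU₀M : ∀ z, |U₀ z| ≤ M := fun z => by
    rw [abs_of_nonneg (hU₀0 z)]; exact (hU₀Ψ z).trans (hΨM z)
  obtain ⟨U, hUu, hU₀U, hUf⟩ := exists_uscEnvelope hU₀M
  have hUΨ : ∀ z, U z ≤ Ψ z := by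
    intro z
    by_contra! hlt
    obtain ⟨t, ht1, ht2⟩ := exists_between hlt
    obtain ⟨x, hx1, hx2⟩ := ((hUf z t ht2).and_eventually
      (hΨc.continuousAt.eventually_lt_const ht1)).exists
    linarith [hU₀Ψ x]
  have hUs : JetSubsolution G v U := by
    refine JetSubsolution.of_family hG hv (S := S) (fun s hs => hs.1)
      (fun s hs z => (hSU₀ s hs z).trans (hU₀U z)) fun y t ht => (hUf y t ht).mono fun z hz => ?_
    obtain ⟨s, hs⟩ := exists_lt_of_lt_ciSup hz
    exact ⟨s.1, s.2, hs⟩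
  have hU0 : ∀ z, 0 ≤ U z := fun z => (hU₀0 z).trans (hU₀U z)
  have hUM : ∀ z, |-U z| ≤ M := fun z => by
    rw [abs_neg, abs_of_nonneg (hU0 z)]; exact (hUΨ z).trans (hΨM z)
  obtain ⟨N, hNu, hUN, hNf⟩ := exists_uscEnvelope hUM
  have hNU : ∀ z, -N z ≤ U z := fun z => by linarith [hUN z]
  refine ⟨U, fun z => -N z, hUu, by simpa using hNu, hUs, ?_, fun z => ?_, hNU, hUΨ⟩
  · refine jetSupersolution_of_maximal hG' hGm hK hv hUu hUs hNU (fun y t ht => ?_) hUΨ hΨc hΨ ?_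
    · exact (hNf y (-t) (by linarith)).mono fun z hz => by linarith
    · exact fun W hW hWs _ hWΨ z => (hSU₀ W ⟨⟨hW, hWs⟩, hWΨ⟩ z).trans (hU₀U z)
  · by_contra! hlt
    obtain ⟨x, hx⟩ := (hNf z 0 (by linarith)).exists
    linarith [hU0 x]

variable {n : ℕ} {F : Mat n → ℝ} {lam Lam : ℝ}

theorem formOp_zero (hFh : PositivelyHomogeneous n F) : formOp n F 0 = 0 := by
  have h := hFh (formMatrix n 0) 0 le_rfl
  rw [zero_mul] at h
  have h0 : (0 : ℝ) • formMatrix n 0 = formMatrix n 0 := by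
    ext i j
    simp [formMatrix]
  rw [h0] at h
  exact h

theorem jetSubsolution_zero (hF : UniformlyElliptic n lam Lam F) (hlam : 0 < lam)
    (hLam : lam ≤ Lam) (hFh : PositivelyHomogeneous n F) {v : En n → ℝ} (hv0 : ∀ y, 0 ≤ v y) :
    JetSubsolution (formOp n F) v fun _ => 0 := by
  intro y p B hB hJ
  obtain ⟨rfl, hB0⟩ := hJ.of_isLocalMin (Eventually.of_forall fun k => le_rfl)
  have h := formOp_antitone hF hlam hLam (B₁ := 0) (B₂ := B) (fun _ _ => rfl) hB
    (fun k => by simpa using hB0 k)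
  rw [formOp_zero hFh] at h
  have := hv0 y
  simp only [_root_.zero_apply]
  linarith

/-- A large multiple of the Gaussian is a supersolution. -/
theorem exists_gauss_jetSupersolution (hF : UniformlyElliptic n lam Lam F) (hlam : 0 < lam)
    (hLam : lam ≤ Lam) (hn : 1 ≤ n) (hFh : PositivelyHomogeneous n F) {v : En n → ℝ} {K : ℝ}
    (hK : 0 ≤ K) (hv : ∀ y, |v y| ≤ K * ((1 + ‖y‖ ^ 2) * gauss (1 / (8 * Lam)) y)) :
    ∃ C, 0 < C ∧ JetSubsolution (fun B => -formOp n F (-B)) (fun y => -v y)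
      fun y => -(C * gauss (1 / (8 * Lam)) y) := by
  obtain ⟨c, hc, hgauss⟩ := formOp_add_gauss_ge hF hlam hLam hn
  refine ⟨K / c + 1, by positivity, fun y p B hB hJ => ?_⟩
  set b := 1 / (8 * Lam)
  set C := K / c + 1
  have hC : 0 ≤ C := by positivity
  have hCK : K ≤ C * c := by
    have : K / c * c = K := div_mul_cancel₀ K hc.ne'
    linarith [add_mul (K / c) 1 c]
  obtain ⟨hp, hBB⟩ := (hJ.add ((hasJet_gauss b y).smul C).jetAbove).of_isLocalMin
    (Eventually.of_forall fun k => by simp)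
  have h1 := hgauss C hC y 0 (fun _ _ => rfl)
  have hH : 0 + C • gaussHess b y = C • gaussHess b y := by
    ext k l
    exact zero_add (((C • gaussHess b y) k) l)
  rw [formOp_zero hFh, zero_add, hH] at h1
  have h2 : formOp n F (C • gaussHess b y) ≤ formOp n F (-B) := by
    refine formOp_antitone hF hlam hLam (by simpa using hB) (fun k l => ?_) fun k => ?_
    · simp only [_root_.smul_apply, gaussHess_symm b y k l]
    · have := hBB k
      rw [_root_.add_apply, _root_.add_apply] at this
      rw [_root_.neg_apply, _root_.neg_apply]
      exact neg_le_iff_add_nonneg'.2 this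
  have h3 : p y + (C • gaussGrad b y) y = 0 := by
    rw [← _root_.add_apply, hp, _root_.zero_apply]
  have h4 : 0 ≤ (1 + ‖y‖ ^ 2) * gauss b y := mul_nonneg (by positivity) (gauss_pos b y).le
  have h5 := mul_le_mul_of_nonneg_right hCK h4
  have h6 := (le_abs_self _).trans (hv y)
  rw [← mul_assoc] at h1
  show -formOp n F (-B) - 1 / 2 * p y ≤ -v y
  generalize (C • gaussGrad b y) y = q at h1 h3
  linarith

theorem memX.exists_abs_le {b : ℝ} {u : En n → ℝ} (hu : memX n b u) :
    ∃ K, 0 ≤ K ∧ ∀ y, |u y| ≤ K * ((1 + ‖y‖ ^ 2) * gauss b y) := by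
  obtain ⟨K, hK⟩ := hu.2
  have hle : ∀ y, |u y| * exp (b * ‖y‖ ^ 2) / (1 + ‖y‖ ^ 2) ≤ K := fun y => hK ⟨y, rfl⟩
  refine ⟨K, le_trans (by positivity) (hle 0), fun y => ?_⟩
  have h := hle y
  rw [div_le_iff₀ (by positivity)] at h
  have he : exp (b * ‖y‖ ^ 2) * gauss b y = 1 := by
    rw [gauss, ← Real.exp_add]; simp
  calc |u y| = |u y| * exp (b * ‖y‖ ^ 2) * gauss b y := by rw [mul_assoc, he, mul_one]
    _ ≤ K * (1 + ‖y‖ ^ 2) * gauss b y := mul_le_mul_of_nonneg_right h (gauss_pos b y).le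
    _ = _ := mul_assoc _ _ _

theorem memX_of_abs_le_gauss {b C : ℝ} {u : En n → ℝ} (hu : Continuous u)
    (h : ∀ y, |u y| ≤ C * gauss b y) : memX n b u := by
  refine ⟨hu, C, ?_⟩
  rintro _ ⟨y, rfl⟩
  have he : gauss b y * exp (b * ‖y‖ ^ 2) = 1 := by
    rw [gauss, ← Real.exp_add]; simp
  have h1 : |u y| * exp (b * ‖y‖ ^ 2) ≤ C := by
    calc |u y| * exp (b * ‖y‖ ^ 2) ≤ C * gauss b y * exp (b * ‖y‖ ^ 2) := by gcongr; exact h y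
      _ = C := by rw [mul_assoc, he, mul_one]
  show |u y| * exp (b * ‖y‖ ^ 2) / (1 + ‖y‖ ^ 2) ≤ C
  refine (div_le_self (by positivity) ?_).trans h1
  linarith [sq_nonneg ‖y‖]

theorem eventually_abs_le_of_weight {b K : ℝ} (hb : 0 < b) {u : En n → ℝ}
    (h : ∀ y, |u y| ≤ K * ((1 + ‖y‖ ^ 2) * gauss b y)) {η : ℝ} (hη : 0 < η) :
    ∀ᶠ y in cocompact (En n), |u y| ≤ η := by
  have ht := (tendsto_one_add_sq_mul_gauss (E := En n) hb).const_mul K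
  rw [mul_zero] at ht
  filter_upwards [ht.eventually_lt_const hη] with y hy
  exact (h y).trans hy.le

theorem abs_le_of_weight {b K : ℝ} (hb : 0 < b) (hK : 0 ≤ K) {u : En n → ℝ}
    (h : ∀ y, |u y| ≤ K * ((1 + ‖y‖ ^ 2) * gauss b y)) (y : En n) : |u y| ≤ K * (1 + 1 / b) :=
  (h y).trans (mul_le_mul_of_nonneg_left (one_add_sq_mul_gauss_le hb y) hK)

/-- Comparison principle between semicontinuous functions dominated by the weight of `X`. -/
theorem le_of_jetSubsolution_of_weight (hF : UniformlyElliptic n lam Lam F) (hlam : 0 < lam)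
    (hLam : lam ≤ Lam) (hn : 1 ≤ n) {v u₁ u₂ : En n → ℝ} {K : ℝ} (hv : Continuous v)
    (hs₁ : JetSubsolution (formOp n F) v u₁)
    (hs₂ : JetSubsolution (fun B => -formOp n F (-B)) (fun y => -v y) fun y => -u₂ y)
    (hu₁ : UpperSemicontinuous u₁) (hu₂ : UpperSemicontinuous fun y => -u₂ y) (hK : 0 ≤ K)
    (h₁ : ∀ y, |u₁ y| ≤ K * ((1 + ‖y‖ ^ 2) * gauss (1 / (8 * Lam)) y))
    (h₂ : ∀ y, |u₂ y| ≤ K * ((1 + ‖y‖ ^ 2) * gauss (1 / (8 * Lam)) y)) (x : En n) :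
    u₁ x ≤ u₂ x := by
  have hb : 0 < 1 / (8 * Lam) := by have := hlam.trans_le hLam; positivity
  exact le_of_jetSubsolution hF hlam hLam hn hv hs₁ hs₂ hu₁ hu₂ (abs_le_of_weight hb hK h₁)
    (abs_le_of_weight hb hK h₂)
    (fun η hη => (eventually_abs_le_of_weight hb h₁ hη).mono fun y hy => (le_abs_self _).trans hy)
    (fun η hη => (eventually_abs_le_of_weight hb h₂ hη).mono fun y hy => (neg_le_abs _).trans hy) x

theorem ViscSolE.le_of_memX (hF : UniformlyElliptic n lam Lam F) (hlam : 0 < lam)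
    (hLam : lam ≤ Lam) (hn : 1 ≤ n) {v u₁ u₂ : En n → ℝ} (hv : Continuous v)
    (hs₁ : ViscSolE n univ (Fop n F 0 v) u₁) (hs₂ : ViscSolE n univ (Fop n F 0 v) u₂)
    (h₁ : memX n (1 / (8 * Lam)) u₁) (h₂ : memX n (1 / (8 * Lam)) u₂) (x : En n) :
    u₁ x ≤ u₂ x := by
  obtain ⟨K₁, hK₁, hb₁⟩ := h₁.exists_abs_le
  obtain ⟨K₂, hK₂, hb₂⟩ := h₂.exists_abs_le
  have hw : ∀ y : En n, 0 ≤ (1 + ‖y‖ ^ 2) * gauss (1 / (8 * Lam)) y := fun y =>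
    mul_nonneg (by positivity) (gauss_pos _ y).le
  exact le_of_jetSubsolution_of_weight hF hlam hLam hn hv
    ((viscSubE_iff_jetSubsolution hF hlam hLam).1 hs₁.1)
    ((viscSupE_iff_jetSubsolution hF hlam hLam).1 hs₂.2) h₁.1.upperSemicontinuous
    h₂.1.neg.upperSemicontinuous (K := K₁ + K₂) (by positivity)
    (fun y => (hb₁ y).trans (mul_le_mul_of_nonneg_right (by linarith) (hw y)))
    (fun y => (hb₂ y).trans (mul_le_mul_of_nonneg_right (by linarith) (hw y))) x

theorem exists_viscSolE_le_gauss (hF : UniformlyElliptic n lam Lam F) (hlam : 0 < lam)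
    (hLam : lam ≤ Lam) (hn : 1 ≤ n) (hFh : PositivelyHomogeneous n F) {v : En n → ℝ}
    (hv : memX n (1 / (8 * Lam)) v) (hv0 : ∀ y, 0 ≤ v y) :
    ∃ u : En n → ℝ, Continuous u ∧ ViscSolE n univ (Fop n F 0 v) u ∧
      ∃ C, 0 < C ∧ ∀ y, 0 ≤ u y ∧ u y ≤ C * gauss (1 / (8 * Lam)) y := by
  have hLam0 := hlam.trans_le hLam
  obtain ⟨K, hK, hvK⟩ := hv.exists_abs_le
  obtain ⟨C, hC, hsup⟩ := exists_gauss_jetSupersolution hF hlam hLam hn hFh hK hvK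
  have hg := gauss_pos (E := En n) (1 / (8 * Lam))
  obtain ⟨U, V, hUu, hVu, hU, hV, hV0, hVU, hUC⟩ := exists_perron (K := n * Lam)
    (fun B hB c hc => formOp_le_add hF hlam hLam hB hc)
    (fun B hB c hc => formOp_sub_le hF hlam hLam hB hc)
    (fun B₁ B₂ h₁ h₂ h => formOp_antitone hF hlam hLam h₁ h₂ h) (by positivity) hv.1
    (M := C) (continuous_const.mul (continuous_gauss _)) (fun z => (mul_pos hC (hg z)).le)
    (fun z => mul_le_of_le_one_right hC.le (gauss_le_one (by positivity) z)) hsup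
    (jetSubsolution_zero hF hlam hLam hFh hv0)
  have hle : ∀ y, C * gauss (1 / (8 * Lam)) y ≤
      C * ((1 + ‖y‖ ^ 2) * gauss (1 / (8 * Lam)) y) := fun y => by
    refine mul_le_mul_of_nonneg_left (le_mul_of_one_le_left (hg y).le ?_) hC.le
    linarith [sq_nonneg ‖y‖]
  have hUV : ∀ z, U z ≤ V z := le_of_jetSubsolution_of_weight hF hlam hLam hn hv.1 hU hV hUu hVu
    hC.le (fun y => by rw [abs_of_nonneg ((hV0 y).trans (hVU y))]; exact (hUC y).trans (hle y))
    (fun y => by rw [abs_of_nonneg (hV0 y)]; exact ((hVU y).trans (hUC y)).trans (hle y))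
  obtain rfl : V = U := funext fun z => (hVU z).antisymm (hUV z)
  refine ⟨V, ?_, ⟨(viscSubE_iff_jetSubsolution hF hlam hLam).2 hU,
    (viscSupE_iff_jetSubsolution hF hlam hLam).2 hV⟩, C, hC, fun y => ⟨hV0 y, hUC y⟩⟩
  refine continuous_iff_lower_upperSemicontinuous.2 ⟨fun x t ht => ?_, hUu⟩
  exact (hVu x (-t) (by simpa using ht)).mono fun z hz => by linarith

end Existence

/-- **Proposition 3.5.** For each `v ∈ X` with `v ≥ 0`, there is a unique viscosity solution
`u ∈ X` of `F(D²u) - (1/2) y·Du = v` in `ℝⁿ`; moreover `u ∈ D`, i.e.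
`0 ≤ u(y) ≤ C e^{-b|y|²}` for some `C > 0`, where `b = 1/(8Λ)`. -/
theorem unique_solution_allspace (n : ℕ) (hn : 1 ≤ n) (lam Lam : ℝ)
    (hlam : 0 < lam) (hLam : lam ≤ Lam)
    (F : Mat n → ℝ) (hF : UniformlyElliptic n lam Lam F) (hFh : PositivelyHomogeneous n F)
    (v : En n → ℝ) (hv : memX n (1/(8*Lam)) v) (hv0 : ∀ y, 0 ≤ v y) :
    (∃! u : En n → ℝ, memX n (1/(8*Lam)) u ∧
      ViscSolE n Set.univ (Fop n F 0 v) u) ∧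
    (∀ u : En n → ℝ, memX n (1/(8*Lam)) u → ViscSolE n Set.univ (Fop n F 0 v) u →
      ∃ C : ℝ, 0 < C ∧ ∀ y : En n, 0 ≤ u y ∧ u y ≤ C * Real.exp (-(1/(8*Lam)) * ‖y‖ ^ 2)) := by
  obtain ⟨u, huc, hu, C, hC, hbound⟩ := exists_viscSolE_le_gauss hF hlam hLam hn hFh hv hv0
  have huX : memX n (1 / (8 * Lam)) u := memX_of_abs_le_gauss huc fun y => by
    rw [abs_of_nonneg (hbound y).1]; exact (hbound y).2
  have huniq : ∀ w : En n → ℝ, memX n (1 / (8 * Lam)) w →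
      ViscSolE n Set.univ (Fop n F 0 v) w → w = u := fun w hwX hw => funext fun y =>
    (hw.le_of_memX hF hlam hLam hn hv.1 hu hwX huX y).antisymm
      (hu.le_of_memX hF hlam hLam hn hv.1 hw huX hwX y)
  refine ⟨⟨u, ⟨huX, hu⟩, fun w hw => huniq w hw.1 hw.2⟩, fun w hwX hw => ?_⟩
  rw [huniq w hwX hw]
  exact ⟨C, hC, hbound⟩
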